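/- Suppose d ≥ 2 is even and let Φ ∈ 𝒮(ℝ^d). Then there is a unique smooth function f : ℝ∖{0} → ℂ such that ∫_{ℝ^d} g(q_d(x)) Φ(x) dx = ∫_ℝ g(ξ) f(ξ) dξ for every continuous compactly supported g : ℝ → ℂ whose support does not contain 0. Moreover f, together with all its derivatives, decays rapidly at infinity (|ξ|^N f^{(k)}(ξ) → 0 as |ξ| → ∞ for all N, k), and there exist smooth functions C₀, C₁ : ℝ → ℂ such that for all ξ ≠ 0: f(ξ) = C₀(ξ) + C₁(ξ)·|ξ|^{d/2−1}·log|ξ| if d ≡ 2 (mod 4), and f(ξ) = C₀(ξ) + C₁(ξ)·|ξ|^{d/2−1} if d ≡ 0 (mod 4). -/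

import Mathlib

open MeasureTheory Filter

noncomputable section

/-- Extension of a vector in `ℝ^d` by zeros, for convenient indexing. -/
def padR {d : ℕ} (x : Fin d → ℝ) (n : ℕ) : ℝ :=
  if h : n < d then x ⟨n, h⟩ else 0

/-- The split quadratic form `q_d` on `ℝ^d`. -/
def splitQR (d : ℕ) (x : Fin d → ℝ) : ℝ :=
  if Even d then ∑ i ∈ Finset.range (d / 2), padR x (2 * i) * padR x (2 * i + 1)
  else padR x 0 ^ 2 + ∑ i ∈ Finset.range (d / 2), padR x (2 * i + 1) * padR x (2 * i + 2)


open scoped ContDiff in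
/-- Borel's lemma in iterated form. -/
theorem borel_aux (c : ℕ → ℂ) : ∃ (χ : ℕ → ℝ → ℂ) (D : ℕ → ℝ → ℂ),
    (∀ j, ContDiff ℝ ∞ (χ j)) ∧ (∀ j, χ j =ᶠ[nhds 0] fun _ => 1) ∧
    (∀ n, ContDiff ℝ ∞ (D n)) ∧
    ∀ n x, D n x = c n * χ n x + (x : ℂ) * D (n + 1) x := by
  obtain ⟨ψ⟩ : Nonempty (ContDiffBump (0 : ℝ)) := inferInstance
  let φ : ℕ → ℝ → ℂ := fun p x => (x : ℂ) ^ p * (ψ x : ℂ)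
  have hψ : ContDiff ℝ ∞ (fun x => (ψ x : ℂ)) := Complex.ofRealCLM.contDiff.comp ψ.contDiff
  have hφ : ∀ p, ContDiff ℝ ∞ (φ p) := fun p =>
    (Complex.ofRealCLM.contDiff.pow p).mul hψ
  have hφc : ∀ p, HasCompactSupport (φ p) := fun p => by
    have : HasCompactSupport (fun x => (ψ x : ℂ)) :=
      ψ.hasCompactSupport.comp_left (g := fun r : ℝ => (r : ℂ)) (by simp)
    exact this.mul_left
  have hM : ∀ p k, ∃ M : ℝ, 0 ≤ M ∧ ∀ x, ‖iteratedDeriv k (φ p) x‖ ≤ M := by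
    intro p k
    have hc : HasCompactSupport (iteratedDeriv k (φ p)) := by
      have h := (hφc p).iteratedFDeriv (𝕜 := ℝ) k
      refine h.mono' ?_
      intro x hx
      apply subset_closure
      intro h0
      apply hx
      rw [iteratedDeriv_eq_iteratedFDeriv, h0]; rfl
    have hcont : Continuous (iteratedDeriv k (φ p)) :=
      (hφ p).continuous_iteratedDeriv k (by exact_mod_cast le_top)
    obtain ⟨C, hC⟩ := hc.exists_bound_of_continuous hcont
    exact ⟨C, (norm_nonneg _).trans (hC 0), hC⟩
  choose M hM0 hM using hM
  let K : ℕ → ℝ := fun j => ∑ p ∈ Finset.range (j+1), ∑ k ∈ Finset.range (j+1), M p k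
  have hK0 : ∀ j, 0 ≤ K j := fun j =>
    Finset.sum_nonneg fun p _ => Finset.sum_nonneg fun k _ => hM0 p k
  have hK : ∀ j p k, p ≤ j → k ≤ j → M p k ≤ K j := by
    intro j p k hp hk
    calc M p k ≤ ∑ k ∈ Finset.range (j+1), M p k :=
          Finset.single_le_sum (f := fun k => M p k) (fun k _ => hM0 p k)
            (Finset.mem_range.2 (by omega))
      _ ≤ K j := Finset.single_le_sum (f := fun p => ∑ k ∈ Finset.range (j+1), M p k)
            (fun p _ => Finset.sum_nonneg fun k _ => hM0 p k) (Finset.mem_range.2 (by omega))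
  let L : ℕ → ℝ := fun j => 2 ^ j * (1 + ‖c j‖) * (1 + K j)
  have hL1 : ∀ j, 1 ≤ L j := by
    intro j
    have h1 : (1:ℝ) ≤ 2 ^ j := one_le_pow₀ (by norm_num)
    have h2 : 1 ≤ 1 + ‖c j‖ := by linarith [norm_nonneg (c j)]
    have h3 : 1 ≤ 1 + K j := by linarith [hK0 j]
    exact one_le_mul_of_one_le_of_one_le (one_le_mul_of_one_le_of_one_le h1 h2) h3
  let T : ℕ → ℕ → ℝ → ℂ := fun n i x => c (n+i) * ((x:ℂ) ^ i * (ψ (L (n+i) * x) : ℂ))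
  have hTeq : ∀ n i, T n i = fun x => (c (n+i) * ((L (n+i) : ℂ)⁻¹) ^ i) * φ i (L (n+i) * x) := by
    intro n i
    funext x
    have : (L (n+i) : ℂ) ≠ 0 := by
      exact_mod_cast (zero_lt_one.trans_le (hL1 (n+i))).ne'
    simp only [T, φ]
    push_cast
    rw [mul_pow, inv_pow]
    field_simp
  have hT : ∀ n i, ContDiff ℝ ∞ (T n i) := by
    intro n i
    rw [hTeq]
    exact contDiff_const.mul ((hφ i).comp (contDiff_const.mul contDiff_id))
  have hbound : ∀ n k i, k < i → ∀ x, ‖iteratedFDeriv ℝ k (T n i) x‖ ≤ (1/2) ^ i := by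
    intro n k i hki x
    rw [norm_iteratedFDeriv_eq_norm_iteratedDeriv, hTeq]
    have hphi : ContDiff ℝ k (φ i) := (hφ i).of_le (by exact_mod_cast le_top)
    rw [iteratedDeriv_const_mul_field, iteratedDeriv_comp_const_smul hphi]
    have hLp := zero_lt_one.trans_le (hL1 (n+i))
    rw [norm_mul, norm_mul, norm_smul, norm_pow, norm_pow, norm_inv, Complex.norm_real,
      Real.norm_of_nonneg hLp.le]
    have h1 : ‖iteratedDeriv k (φ i) (L (n+i) * x)‖ ≤ K (n+i) :=
      (hM i k _).trans (hK _ _ _ (by omega) (by omega))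
    have h2 : (L (n+i))⁻¹ ^ i * L (n+i) ^ k ≤ (L (n+i))⁻¹ := by
      obtain ⟨r, rfl⟩ : ∃ r, i = k + 1 + r := ⟨i - k - 1, by omega⟩
      generalize hl : L (n + (k+1+r)) = l at *
      have hl1 : 1 ≤ l := hl ▸ hL1 _
      have : l⁻¹ ^ (k+1+r) * l ^ k = l⁻¹ * l⁻¹ ^ r := by
        rw [pow_add, pow_add]; simp only [inv_pow]; field_simp
      rw [this]
      exact mul_le_of_le_one_right (by positivity) (pow_le_one₀ (by positivity) (inv_le_one_of_one_le₀ hl1))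
    calc ‖c (n+i)‖ * (L (n+i))⁻¹ ^ i * (L (n+i) ^ k * ‖iteratedDeriv k (φ i) (L (n+i) * x)‖)
        = ‖c (n+i)‖ * ((L (n+i))⁻¹ ^ i * L (n+i) ^ k) * ‖iteratedDeriv k (φ i) (L (n+i) * x)‖ := by ring
      _ ≤ ‖c (n+i)‖ * (L (n+i))⁻¹ * K (n+i) := by gcongr
      _ ≤ (1/2)^(n+i) := by
          have e1 : (0:ℝ) < 2 ^ (n+i) := by positivity
          have e2 : 0 < 1 + ‖c (n+i)‖ := by positivity
          have e3 : 0 < 1 + K (n+i) := by linarith [hK0 (n+i)]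
          have : ‖c (n+i)‖ * (L (n+i))⁻¹ * K (n+i) =
            (1/2)^(n+i) * ((‖c (n+i)‖/(1 + ‖c (n+i)‖)) * (K (n+i) / (1 + K (n+i)))) := by
            simp only [L, one_div, inv_pow]; field_simp
          rw [this]
          apply mul_le_of_le_one_right (by positivity)
          apply mul_le_one₀
          · rw [div_le_one e2]; linarith
          · have := hK0 (n+i); positivity
          · rw [div_le_one e3]; linarith
      _ ≤ (1/2)^i := pow_le_pow_of_le_one (by norm_num) (by norm_num) (by omega)
  refine ⟨fun j x => (ψ (L j * x) : ℂ), fun n x => ∑' i, T n i x, ?_, ?_, ?_, ?_⟩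
  · intro j
    exact hψ.comp (contDiff_const.mul contDiff_id)
  · intro j
    have h1 : Tendsto (fun x : ℝ => L j * x) (nhds 0) (nhds 0) := by
      have : Continuous (fun x : ℝ => L j * x) := by fun_prop
      simpa using this.tendsto 0
    filter_upwards [h1.eventually ψ.eventuallyEq_one] with x hx
    simp [hx]
  · intro n
    refine contDiff_tsum_of_eventually (N := ⊤) (v := fun k i => (1/2 : ℝ)^i) (hT n) ?_ ?_
    · intro k _; exact summable_geometric_of_lt_one (by norm_num) (by norm_num)
    · intro k _
      rw [Nat.cofinite_eq_atTop]
      filter_upwards [eventually_gt_atTop k] with i hi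
      exact hbound n k i hi
  · intro n x
    have hs : Summable (fun i => T n i x) := by
      refine Summable.of_norm_bounded_eventually_nat (g := fun i => (1/2 : ℝ)^i) (summable_geometric_of_lt_one (by norm_num) (by norm_num)) ?_
      filter_upwards [eventually_gt_atTop 0] with i hi
      simpa using hbound n 0 i hi x
    beta_reduce
    rw [hs.tsum_eq_zero_add, ← tsum_mul_left]
    congr 1
    · simp [T]
    · refine tsum_congr fun i => ?_
      simp only [T]
      rw [show n + (i+1) = n + 1 + i by ring, pow_succ]
      ring

/-- The Fourier transform of the pushforward of `φ μ` under `q`. -/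
def chF {X : Type*} [MeasurableSpace X] (μ : Measure X) (q : X → ℝ) (φ : X → ℂ) (t : ℝ) : ℂ :=
  ∫ x, Complex.exp (-(2 * Real.pi * t * q x : ℝ) * Complex.I) * φ x ∂μ

section chF
variable {X : Type*} [MeasurableSpace X] {μ : Measure X} {q : X → ℝ} {φ : X → ℂ}

lemma norm_cexp_aux (r : ℝ) : ‖Complex.exp (-(r : ℂ) * Complex.I)‖ = 1 := by
  rw [← Complex.ofReal_neg, Complex.norm_exp_ofReal_mul_I]

lemma chF_integrable (hq : Measurable q) (h : Integrable φ μ) (t : ℝ) :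
    Integrable (fun x => Complex.exp (-(2 * Real.pi * t * q x : ℝ) * Complex.I) * φ x) μ := by
  refine h.bdd_mul (c := 1) ?_ ?_
  · exact Measurable.aestronglyMeasurable (by fun_prop)
  · exact ae_of_all _ fun x => (norm_cexp_aux _).le

lemma chF_norm_le (t : ℝ) : ‖chF μ q φ t‖ ≤ ∫ x, ‖φ x‖ ∂μ := by
  refine (norm_integral_le_integral_norm _).trans (le_of_eq ?_)
  congr 1; funext x
  rw [norm_mul, norm_cexp_aux, one_mul]

lemma chF_hasDerivAt (hq : Measurable q) (h : Integrable φ μ)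
    (h1 : Integrable (fun x => (q x : ℂ) * φ x) μ) (t : ℝ) :
    HasDerivAt (chF μ q φ) (-(2 * Real.pi * Complex.I) * chF μ q (fun x => (q x : ℂ) * φ x) t) t := by
  have key := hasDerivAt_integral_of_dominated_loc_of_deriv_le (μ := μ)
    (F := fun (t : ℝ) x => Complex.exp (-(2 * Real.pi * t * q x : ℝ) * Complex.I) * φ x)
    (F' := fun (t : ℝ) x => -(2 * Real.pi * Complex.I) *
      (Complex.exp (-(2 * Real.pi * t * q x : ℝ) * Complex.I) * ((q x : ℂ) * φ x)))
    (x₀ := t) (s := Set.univ) (bound := fun x => 2 * Real.pi * ‖(q x : ℂ) * φ x‖)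
    univ_mem
    (Eventually.of_forall fun t => (chF_integrable hq h t).aestronglyMeasurable)
    (chF_integrable hq h t)
    ((chF_integrable hq h1 t).aestronglyMeasurable.const_mul _)
    (ae_of_all _ fun x t _ => by
      rw [norm_mul, norm_mul (Complex.exp _), norm_cexp_aux, one_mul]
      simp [abs_of_pos Real.pi_pos])
    (h1.norm.const_mul _)
    (ae_of_all _ fun x t _ => by
      have h3 : HasDerivAt (fun t : ℝ => (-(2 * Real.pi * t * q x : ℝ) * Complex.I : ℂ))
          (-(2 * Real.pi * q x : ℝ) * Complex.I) t := by
        have : HasDerivAt (fun t : ℝ => ((2 * Real.pi * t * q x : ℝ) : ℂ)) ((2 * Real.pi * q x : ℝ) : ℂ) t := by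
          apply HasDerivAt.ofReal_comp
          have := ((hasDerivAt_id t).const_mul (2 * Real.pi)).mul_const (q x)
          simpa using this
        exact (this.neg.mul_const _)
      have h4 := (h3.cexp).mul_const (φ x)
      refine h4.congr_deriv ?_
      push_cast
      ring)
  have := key.2
  rw [integral_const_mul] at this
  exact this

lemma chF_continuous (hq : Measurable q) (h : Integrable φ μ) : Continuous (chF μ q φ) := by
  refine continuous_of_dominated (bound := fun x => ‖φ x‖)
    (fun t => (chF_integrable hq h t).aestronglyMeasurable) ?_ h.norm ?_
  · exact fun t => ae_of_all _ fun x => by rw [norm_mul, norm_cexp_aux, one_mul]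
  · exact ae_of_all _ fun x => by fun_prop

/-- derivative tower -/
lemma chF_tower (hq : Measurable q) (h : ∀ k : ℕ, Integrable (fun x => (q x : ℂ) ^ k * φ x) μ)
    (k : ℕ) (t : ℝ) :
    HasDerivAt (fun t => (-(2 * Real.pi * Complex.I)) ^ k * chF μ q (fun x => (q x : ℂ) ^ k * φ x) t)
      ((-(2 * Real.pi * Complex.I)) ^ (k+1) * chF μ q (fun x => (q x : ℂ) ^ (k+1) * φ x) t) t := by
  have h1 : (fun x => (q x : ℂ) ^ (k+1) * φ x) = (fun x => (q x : ℂ) * ((q x : ℂ) ^ k * φ x)) := by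
    funext x; ring
  have := (chF_hasDerivAt hq (h k) (h1 ▸ h (k+1)) t).const_mul ((-(2 * Real.pi * Complex.I)) ^ k)
  rw [h1, pow_succ]
  exact this.congr_deriv (by ring)

lemma chF_pairing [SFinite μ] (hq : Measurable q) (h : Integrable φ μ) {g gh : ℝ → ℂ} (hgh : Integrable gh)
    (hg : ∀ u, g u = ∫ t, Complex.exp ((2 * Real.pi * t * u : ℝ) * Complex.I) * gh t) :
    ∫ x, g (q x) * φ x ∂μ = ∫ t, gh t * chF μ q φ (-t) := by
  have e1 : ∀ x, g (q x) * φ x =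
      ∫ t, Complex.exp ((2 * Real.pi * t * q x : ℝ) * Complex.I) * (gh t * φ x) := by
    intro x
    rw [hg, ← integral_mul_const]
    congr 1; funext t; ring
  have e2 : ∀ t, gh t * chF μ q φ (-t) =
      ∫ x, Complex.exp ((2 * Real.pi * t * q x : ℝ) * Complex.I) * (gh t * φ x) ∂μ := by
    intro t
    rw [chF, ← integral_const_mul]
    congr 1; funext x
    push_cast
    ring_nf
  simp_rw [e1, e2]
  rw [integral_integral_swap]
  have hI : Integrable (fun p : X × ℝ => φ p.1 * gh p.2) (μ.prod volume) := h.mul_prod hgh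
  have := hI.bdd_mul (f := fun p : X × ℝ => Complex.exp ((2 * Real.pi * p.2 * q p.1 : ℝ) * Complex.I))
    (c := 1) (Measurable.aestronglyMeasurable (by fun_prop))
    (ae_of_all _ fun x => (Complex.norm_exp_ofReal_mul_I _).le)
  refine this.congr (ae_of_all _ fun p => ?_)
  simp only [Function.uncurry]
  ring
end chF

/-- Rapid decay at infinity. -/
def RD (f : ℝ → ℂ) : Prop := ∀ N : ℕ, ∃ C : ℝ, ∀ t : ℝ, 1 ≤ |t| → ‖f t‖ * |t| ^ N ≤ C

lemma RD.add {f g : ℝ → ℂ} (hf : RD f) (hg : RD g) : RD (fun t => f t + g t) := by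
  intro N
  obtain ⟨C, hC⟩ := hf N
  obtain ⟨D, hD⟩ := hg N
  refine ⟨C + D, fun t ht => ?_⟩
  calc ‖f t + g t‖ * |t| ^ N ≤ (‖f t‖ + ‖g t‖) * |t| ^ N := by gcongr; exact norm_add_le _ _
    _ ≤ C + D := by rw [add_mul]; exact add_le_add (hC t ht) (hD t ht)

lemma RD.const_mul {f : ℝ → ℂ} (hf : RD f) (c : ℂ) : RD (fun t => c * f t) := by
  intro N
  obtain ⟨C, hC⟩ := hf N
  refine ⟨‖c‖ * C, fun t ht => ?_⟩
  rw [norm_mul, mul_assoc]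
  exact mul_le_mul_of_nonneg_left (hC t ht) (norm_nonneg _)

lemma RD.mono {f : ℝ → ℂ} {g : ℝ → ℂ} (hf : RD f) (h : ∀ t : ℝ, 1 ≤ |t| → ‖g t‖ ≤ ‖f t‖) : RD g := by
  intro N
  obtain ⟨C, hC⟩ := hf N
  refine ⟨C, fun t ht => le_trans ?_ (hC t ht)⟩
  gcongr; exact h t ht

lemma RD_gauss (p : Polynomial ℂ) :
    RD (fun t => p.eval (t : ℂ) * Real.exp (-Real.pi * t ^ 2)) := by
  induction p using Polynomial.induction_on' with
  | add p q hp hq =>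
    have := hp.add hq
    refine this.mono fun t _ => le_of_eq ?_
    rw [Polynomial.eval_add, add_mul]
  | monomial n a =>
    intro N
    refine ⟨‖a‖ * (n + N).factorial, fun t ht => ?_⟩
    simp only [Polynomial.eval_monomial, norm_mul, norm_pow, Complex.norm_real, Real.norm_eq_abs, Real.abs_exp]
    have h1 : |t| ^ (n + N) ≤ (t ^ 2) ^ (n+N) := by
      apply pow_le_pow_left₀ (abs_nonneg _)
      rw [← sq_abs]; nlinarith
    have h2 := Real.pow_div_factorial_le_exp (t^2) (sq_nonneg t) (n+N)
    have hf : (0:ℝ) < (n+N).factorial := by positivity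
    rw [div_le_iff₀ hf] at h2
    have h3 : Real.exp (t^2) * Real.exp (-Real.pi * t^2) ≤ 1 := by
      rw [← Real.exp_add, Real.exp_le_one_iff]
      nlinarith [Real.pi_gt_three, sq_nonneg t]
    have h4 := Real.exp_pos (-Real.pi * t^2)
    calc ‖a‖ * |t| ^ n * Real.exp (-Real.pi * t ^ 2) * |t| ^ N
        = ‖a‖ * (|t| ^ (n+N) * Real.exp (-Real.pi * t ^ 2)) := by ring
      _ ≤ ‖a‖ * ((Real.exp (t^2) * (n+N).factorial) * Real.exp (-Real.pi * t ^ 2)) := by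
          gcongr; exact h1.trans h2
      _ = ‖a‖ * (n+N).factorial * (Real.exp (t^2) * Real.exp (-Real.pi * t^2)) := by ring
      _ ≤ ‖a‖ * (n+N).factorial * 1 := by gcongr
      _ = _ := mul_one _

lemma gauss_poly_deriv (p : Polynomial ℂ) (t : ℝ) :
    HasDerivAt (fun t : ℝ => p.eval (t : ℂ) * Real.exp (-Real.pi * t ^ 2))
      ((Polynomial.derivative p - Polynomial.C (2 * Real.pi : ℂ) * Polynomial.X * p).eval (t : ℂ) *
        Real.exp (-Real.pi * t ^ 2)) t := by
  have h1 : HasDerivAt (fun t : ℝ => p.eval (t : ℂ)) (p.derivative.eval (t : ℂ)) t :=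
    (p.hasDerivAt (t : ℂ)).comp_ofReal
  have h2 : HasDerivAt (fun t : ℝ => ((Real.exp (-Real.pi * t ^ 2) : ℝ) : ℂ))
      ((Real.exp (-Real.pi * t ^ 2) * (-Real.pi * (2 * t)) : ℝ) : ℂ) t := by
    apply HasDerivAt.ofReal_comp
    apply HasDerivAt.exp
    have := (hasDerivAt_pow 2 t).const_mul (-Real.pi)
    simpa using this
  refine (h1.mul h2).congr_deriv ?_
  simp only [Polynomial.eval_sub, Polynomial.eval_mul, Polynomial.eval_C, Polynomial.eval_X]
  push_cast
  ring

/-- tower of derivatives of polynomial times gaussian -/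
lemma gauss_tower (p : Polynomial ℂ) (S : ℝ → ℂ)
    (hS : ∀ t : ℝ, HasDerivAt S (p.eval (t : ℂ) * Real.exp (-Real.pi * t ^ 2)) t) :
    ∃ T : ℕ → ℝ → ℂ, T 0 = S ∧ (∀ j t, HasDerivAt (T j) (T (j+1) t) t) ∧
      ∀ j, RD (T (j+1)) := by
  let P : ℕ → Polynomial ℂ := fun j => Nat.rec p (fun _ r => r.derivative - Polynomial.C (2 * Real.pi : ℂ) * Polynomial.X * r) j
  refine ⟨fun j => Nat.casesOn (motive := fun _ => ℝ → ℂ) j S (fun i (t : ℝ) => (P i).eval (t : ℂ) * Real.exp (-Real.pi * t ^ 2)), rfl, ?_, ?_⟩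
  · intro j t
    cases j with
    | zero => exact hS t
    | succ j => exact gauss_poly_deriv (P j) t
  · intro j; exact RD_gauss (P j)

lemma expand_tower (Fd S : ℕ → ℝ → ℂ) (hFd : ∀ j t, HasDerivAt (Fd j) (Fd (j+1) t) t)
    (hS : ∀ j t, HasDerivAt (S j) (S (j+1) t) t) (h0 : ∀ t : ℝ, (t : ℂ) * Fd 0 t = S 0 t)
    (κ : ℂ) (σ : ℝ → ℂ) (hS0 : RD (fun t => S 0 t - κ * σ t)) (hSj : ∀ j, RD (S (j+1))) (j : ℕ) :
    RD (fun t => Fd j t - (-1) ^ j * j.factorial * κ * σ t / (t : ℂ) ^ (j+1)) := by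
  have key : ∀ j (t : ℝ), (t : ℂ) * Fd (j+1) t + (j + 1 : ℕ) * Fd j t = S (j+1) t := by
    intro j
    induction j with
    | zero =>
      intro t
      have h1 : HasDerivAt (fun t : ℝ => (t : ℂ) * Fd 0 t) (1 * Fd 0 t + (t : ℂ) * Fd 1 t) t :=
        (Complex.ofRealCLM.hasDerivAt (x := t)).mul (hFd 0 t)
      have h2 := hS 0 t
      have h3 : (fun t : ℝ => (t : ℂ) * Fd 0 t) = S 0 := funext h0
      rw [h3] at h1
      have := h1.unique h2
      rw [← this]; push_cast; ring
    | succ j ih =>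
      intro t
      have h1 : HasDerivAt (fun t : ℝ => (t : ℂ) * Fd (j+1) t + (j + 1 : ℕ) * Fd j t)
          (1 * Fd (j+1) t + (t : ℂ) * Fd (j+2) t + (j+1 : ℕ) * Fd (j+1) t) t :=
        ((Complex.ofRealCLM.hasDerivAt (x := t)).mul (hFd (j+1) t)).add ((hFd j t).const_mul _)
      have h2 := hS (j+1) t
      have h3 : (fun t : ℝ => (t : ℂ) * Fd (j+1) t + (j + 1 : ℕ) * Fd j t) = S (j+1) := funext ih
      rw [h3] at h1
      have := h1.unique h2
      rw [← this]; push_cast; ring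
  induction j with
  | zero =>
    refine hS0.mono fun t ht => ?_
    have ht0 : (t : ℂ) ≠ 0 := by
      rintro h; rw [Complex.ofReal_eq_zero] at h; rw [h] at ht; norm_num at ht
    have : Fd 0 t - (-1) ^ 0 * Nat.factorial 0 * κ * σ t / (t : ℂ) ^ (0+1) = (S 0 t - κ * σ t) / t := by
      rw [← h0]; field_simp; simp; ring
    rw [this, norm_div, Complex.norm_real, Real.norm_eq_abs]
    exact div_le_self (norm_nonneg _) ht
  | succ j ih =>
    refine ((hSj j).add (ih.const_mul (-(j+1 : ℕ)))).mono fun t ht => ?_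
    have ht0 : (t : ℂ) ≠ 0 := by
      rintro h; rw [Complex.ofReal_eq_zero] at h; rw [h] at ht; norm_num at ht
    have : Fd (j+1) t - (-1) ^ (j+1) * Nat.factorial (j+1) * κ * σ t / (t : ℂ) ^ (j+1+1) =
        (S (j+1) t + -(j+1 : ℕ) * (Fd j t - (-1) ^ j * Nat.factorial j * κ * σ t / (t : ℂ) ^ (j+1))) / t := by
      rw [← key, Nat.factorial_succ]; push_cast; field_simp; ring
    rw [this, norm_div, Complex.norm_real, Real.norm_eq_abs]
    exact div_le_self (norm_nonneg _) ht

lemma int_inv_sq_Ioi : IntegrableOn (fun s : ℝ => (s ^ 2)⁻¹) (Set.Ioi 1) := by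
  have := integrableOn_Ioi_rpow_of_lt (a := -2) (by norm_num) (c := 1) zero_lt_one
  refine this.congr_fun (fun s hs => ?_) measurableSet_Ioi
  have hs0 : (0:ℝ) < s := zero_lt_one.trans hs
  simp [Real.rpow_neg hs0.le]

/-- the model function attached to `h` -/
def modE (h : ℝ → ℂ) (ξ : ℝ) : ℂ := ∫ s in Set.Ioi (1:ℝ), (s⁻¹ : ℂ) * h (s * ξ)

section model
variable {h : ℝ → ℂ} (hc : Continuous h) (hint : ∀ j : ℕ, Integrable (fun u : ℝ => (u : ℂ) ^ j * h u))
include hc hint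

lemma modE_prod (j : ℕ) : Integrable (fun p : ℝ × ℝ => (p.1 : ℂ) ^ j * ((p.2⁻¹ : ℂ) * h (p.2 * p.1)))
    (volume.prod (volume.restrict (Set.Ioi 1))) := by
  have heq : ∀ s : ℝ, 1 < s → ∀ ξ : ℝ, (ξ : ℂ) ^ j * ((s⁻¹ : ℂ) * h (s * ξ)) =
      ((s : ℂ)⁻¹ ^ (j+1)) * (((s * ξ : ℝ) : ℂ) ^ j * h (s * ξ)) := by
    intro s hs ξ
    have : (s : ℂ) ≠ 0 := by exact_mod_cast (zero_lt_one.trans hs).ne'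
    push_cast
    rw [inv_pow, mul_pow, pow_succ]
    field_simp
  rw [integrable_prod_iff']
  · refine ⟨?_, ?_⟩
    · rw [ae_restrict_iff' measurableSet_Ioi]
      refine ae_of_all _ fun s hs => ?_
      simp_rw [heq s hs]
      apply Integrable.const_mul
      exact (hint j).comp_mul_left' (zero_lt_one.trans hs).ne'
    · refine Integrable.mono' (g := fun s => (∫ u : ℝ, ‖(u : ℂ) ^ j * h u‖) * (s^2)⁻¹)
        (Integrable.const_mul int_inv_sq_Ioi _) ?_ ?_
      · have hm : StronglyMeasurable (fun p : ℝ × ℝ => ‖(p.2 : ℂ) ^ j * ((p.1⁻¹ : ℂ) * h (p.1 * p.2))‖) := by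
          apply Measurable.stronglyMeasurable
          have := hc.measurable
          fun_prop
        exact (hm.integral_prod_right (ν := volume)).aestronglyMeasurable
      · rw [ae_restrict_iff' measurableSet_Ioi]
        refine ae_of_all _ fun s hs => ?_
        have hs1 : (1:ℝ) < s := hs
        have hs0 : (0:ℝ) < s := zero_lt_one.trans hs
        simp_rw [heq s hs, norm_mul ((s : ℂ)⁻¹ ^ (j+1))]
        rw [integral_const_mul]
        rw [Measure.integral_comp_mul_left (fun u : ℝ => ‖(u : ℂ) ^ j * h u‖) s]
        have hI : 0 ≤ ∫ u : ℝ, ‖(u : ℂ) ^ j * h u‖ := integral_nonneg fun _ => norm_nonneg _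
        rw [Real.norm_of_nonneg (by positivity), norm_pow, norm_inv, Complex.norm_real,
          Real.norm_of_nonneg hs0.le, abs_of_pos (by positivity), smul_eq_mul]
        have h1 : s⁻¹ ^ (j+1) ≤ s⁻¹ := by
          rw [pow_succ]
          exact mul_le_of_le_one_left (by positivity) (pow_le_one₀ (by positivity) (inv_le_one_of_one_le₀ hs1.le))
        calc s⁻¹ ^ (j+1) * (s⁻¹ * ∫ u : ℝ, ‖(u : ℂ) ^ j * h u‖)
            ≤ s⁻¹ * (s⁻¹ * ∫ u : ℝ, ‖(u : ℂ) ^ j * h u‖) := by gcongr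
          _ = _ := by rw [← mul_assoc, pow_two, mul_inv]; ring
  · apply Measurable.aestronglyMeasurable
    have := hc.measurable
    fun_prop

lemma modE_integrable (j : ℕ) : Integrable (fun ξ : ℝ => (ξ : ℂ) ^ j * modE h ξ) := by
  have := (modE_prod hc hint j).integral_prod_left
  refine this.congr (ae_of_all _ fun ξ => ?_)
  simp only [modE]
  rw [← integral_const_mul]

lemma modE_chF {hh K : ℝ → ℂ} (hhh : ∀ t, chF volume (fun x => x) h t = hh t)
    (hK : ∀ t, HasDerivAt K (hh t) t) (hK0 : K 0 = 0) (t : ℝ) :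
    (t : ℂ) * chF volume (fun x => x) (modE h) t = K t := by
  have hh0 : Integrable h := by simpa using hint 0
  have hP := modE_prod hc hint 0
  have hP2 : Integrable (fun p : ℝ × ℝ => Complex.exp (-(2 * Real.pi * t * p.1 : ℝ) * Complex.I) *
      ((p.2⁻¹ : ℂ) * h (p.2 * p.1))) (volume.prod (volume.restrict (Set.Ioi 1))) := by
    simp only [pow_zero, one_mul] at hP
    exact hP.bdd_mul (c := 1) (Measurable.aestronglyMeasurable (by fun_prop))
      (ae_of_all _ fun x => (norm_cexp_aux _).le)
  have e1 : chF volume (fun x => x) (modE h) t = ∫ s in Set.Ioi (1:ℝ), ((s^2 : ℝ)⁻¹ : ℂ) * hh (t / s) := by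
    rw [chF]
    simp_rw [modE, ← integral_const_mul]
    rw [integral_integral_swap hP2]
    refine setIntegral_congr_fun measurableSet_Ioi fun s hs => ?_
    have hs0 : (0:ℝ) < s := zero_lt_one.trans hs
    have hs0' : (s : ℂ) ≠ 0 := by exact_mod_cast hs0.ne'
    have := Measure.integral_comp_mul_left (fun u : ℝ => Complex.exp (-(2 * Real.pi * (t/s) * u : ℝ) * Complex.I) * h u) s
    beta_reduce
    rw [← hhh, chF]
    calc _ = ∫ x : ℝ, (s⁻¹ : ℂ) * (Complex.exp (-(2 * Real.pi * (t/s) * (s * x) : ℝ) * Complex.I) * h (s * x)) := by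
          congr 1; funext x
          rw [show 2 * Real.pi * (t/s) * (s * x) = 2 * Real.pi * t * x by field_simp]
          ring
      _ = _ := by
          rw [integral_const_mul, this, abs_of_pos (by positivity)]
          rw [Complex.real_smul, ← mul_assoc]
          congr 1
          push_cast
          field_simp
  rw [e1, ← integral_const_mul]
  have hbd : ∀ t, ‖hh t‖ ≤ ∫ x, ‖h x‖ := fun t => by rw [← hhh]; exact chF_norm_le t
  have hhc : Continuous hh := by
    have := chF_continuous (q := fun x : ℝ => x) (μ := volume) measurable_id hh0
    rwa [show chF volume (fun x => x) h = hh from funext hhh] at this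
  have hI : IntegrableOn (fun s : ℝ => (t : ℂ) * (((s^2 : ℝ)⁻¹ : ℂ) * hh (t / s))) (Set.Ioi 1) := by
    apply Integrable.const_mul
    have h1 : IntegrableOn (fun s : ℝ => ((s^2 : ℝ)⁻¹ : ℂ)) (Set.Ioi 1) := by
      have := Integrable.ofReal (𝕜 := ℂ) int_inv_sq_Ioi
      refine this.congr (ae_of_all _ fun s => ?_)
      simp
    refine Integrable.mul_bdd (c := ∫ x, ‖h x‖) h1 ?_ (ae_of_all _ fun s => hbd _)
    apply Measurable.aestronglyMeasurable
    have := hhc.measurable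
    fun_prop
  have hlim : Tendsto (fun s : ℝ => - K (t / s)) atTop (nhds (-K 0)) := by
    have h1 : Tendsto (fun s : ℝ => t / s) atTop (nhds 0) := tendsto_const_nhds.div_atTop tendsto_id
    exact ((hK 0).continuousAt.tendsto.comp h1).neg
  have hder : ∀ s : ℝ, 0 < s → HasDerivAt (fun s : ℝ => - K (t / s)) ((t : ℂ) * (((s^2 : ℝ)⁻¹ : ℂ) * hh (t / s))) s := by
    intro s hs
    have h1 : HasDerivAt (fun s : ℝ => t / s) (t * (-(s^2)⁻¹)) s := by
      simpa [div_eq_mul_inv] using (hasDerivAt_inv hs.ne').const_mul t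
    have h2 := ((hK (t/s)).scomp s h1).neg
    refine h2.congr_deriv ?_
    rw [Complex.real_smul]
    push_cast
    ring
  have := integral_Ioi_of_hasDerivAt_of_tendsto (a := 1) (f := fun s : ℝ => - K (t / s))
    (hder 1 one_pos).continuousAt.continuousWithinAt (fun s hs => hder s (zero_lt_one.trans hs)) hI hlim
  rw [this, hK0]
  simp
end model

/-- the gaussian -/
def ga (u : ℝ) : ℂ := ((Real.exp (-Real.pi * u ^ 2) : ℝ) : ℂ)

lemma ga_cont : Continuous ga := by unfold ga; fun_prop

lemma ga_neg (u : ℝ) : ga (-u) = ga u := by simp [ga]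

lemma ga_int (j : ℕ) : Integrable (fun u : ℝ => (u : ℂ) ^ j * ga u) := by
  have h := integrable_rpow_mul_exp_neg_mul_sq (b := Real.pi) Real.pi_pos (s := (j:ℝ)) (by linarith [j.cast_nonneg (α := ℝ)])
  refine (h.ofReal (𝕜 := ℂ)).congr (ae_of_all _ fun u => ?_)
  simp [ga]

lemma ga_chF (t : ℝ) : chF volume (fun x => x) ga t = ga t := by
  have := fourierIntegral_gaussian (b := (Real.pi : ℂ)) (by simpa using Real.pi_pos) (-(2 * Real.pi * t : ℝ))
  rw [chF]
  have h1 : (Real.pi : ℂ) ≠ 0 := by exact_mod_cast Real.pi_ne_zero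
  calc _ = ∫ x : ℝ, Complex.exp (Complex.I * (-(2 * Real.pi * t : ℝ)) * x) * Complex.exp (-(Real.pi:ℂ) * x ^ 2) := by
        congr 1; funext x
        congr 1
        · congr 1; push_cast; ring
        · simp [ga]
    _ = _ := by
        rw [this, div_self h1, Complex.one_cpow, one_mul]
        simp only [ga]
        push_cast
        congr 1
        field_simp
        ring

/-- the error function -/
def erf (t : ℝ) : ℂ := ∫ v in (0:ℝ)..t, ga v

lemma erf_deriv (t : ℝ) : HasDerivAt erf (ga t) t := ga_cont.integral_hasStrictDerivAt 0 t |>.hasDerivAt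

lemma erf_neg (t : ℝ) : erf (-t) = - erf t := by
  unfold erf
  have := intervalIntegral.integral_comp_neg (a := 0) (b := t) ga
  simp only [ga_neg, neg_zero] at this
  rw [this, intervalIntegral.integral_symm]

lemma erf_tail (t : ℝ) : erf t = 1/2 - ∫ v in Set.Ioi t, ga v := by
  have hi : Integrable ga := by simpa using ga_int 0
  have h := intervalIntegral.integral_interval_add_Ioi (a := 0) (b := t) (f := ga)
    hi.integrableOn hi.integrableOn
  have h2 : ∫ v in Set.Ioi (0:ℝ), ga v = 1/2 := by
    have := integral_gaussian_Ioi Real.pi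
    rw [div_self Real.pi_ne_zero, Real.sqrt_one] at this
    unfold ga
    rw [integral_complex_ofReal, this]; simp
  rw [← h2, ← h]; simp [erf]

lemma tail_bound (t : ℝ) (ht : 1 ≤ t) : ‖∫ v in Set.Ioi t, ga v‖ ≤ Real.exp (-Real.pi * t ^ 2) := by
  have hi : Integrable ga := by simpa using ga_int 0
  have hd : ∀ x : ℝ, HasDerivAt (fun v : ℝ => - Real.exp (-Real.pi * v^2)) (2 * Real.pi * x * Real.exp (-Real.pi * x^2)) x := by
    intro x
    have h0 : HasDerivAt (fun v : ℝ => -Real.pi * v^2) (-Real.pi * (2 * x)) x := by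
      simpa using (hasDerivAt_pow 2 x).const_mul (-Real.pi)
    exact h0.exp.neg.congr_deriv (by ring)
  have hint : Integrable (fun x : ℝ => 2 * Real.pi * x * Real.exp (-Real.pi * x^2)) := by
    have := (integrable_mul_exp_neg_mul_sq (b := Real.pi) Real.pi_pos).const_mul (2 * Real.pi)
    refine this.congr (ae_of_all _ fun x => ?_)
    ring
  have hl : Tendsto (fun v : ℝ => - Real.exp (-Real.pi * v^2)) atTop (nhds (-0)) := by
    apply Tendsto.neg
    apply Real.tendsto_exp_atBot.comp
    have : Tendsto (fun v : ℝ => v^2) atTop atTop := tendsto_pow_atTop (by norm_num)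
    exact this.const_mul_atTop_of_neg (by linarith [Real.pi_pos])
  have h := integral_Ioi_of_hasDerivAt_of_tendsto (a := t) (hd t).continuousAt.continuousWithinAt
    (fun x _ => hd x) hint.integrableOn hl
  refine (norm_integral_le_integral_norm _).trans ?_
  have : ∫ v in Set.Ioi t, ‖ga v‖ ≤ ∫ x in Set.Ioi t, 2 * Real.pi * x * Real.exp (-Real.pi * x^2) := by
    refine setIntegral_mono_on hi.norm.integrableOn hint.integrableOn measurableSet_Ioi fun x hx => ?_
    have hx1 : 1 < x := lt_of_le_of_lt ht hx
    simp only [ga, Complex.norm_real, Real.norm_eq_abs, Real.abs_exp]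
    apply le_mul_of_one_le_left (Real.exp_pos _).le
    nlinarith [Real.pi_gt_three]
  rw [h] at this
  simpa using this

lemma erf_RD : RD (fun t => erf t - 1/2 * ((t / |t| : ℝ) : ℂ)) := by
  refine (RD_gauss 1).mono fun t ht => ?_
  have hr : ‖(Polynomial.eval (t:ℂ) (1 : Polynomial ℂ)) * (Real.exp (-Real.pi * t ^ 2) : ℝ)‖ = Real.exp (-Real.pi * t ^ 2) := by
    rw [Polynomial.eval_one, one_mul, Complex.norm_real, Real.norm_eq_abs, Real.abs_exp]
  rw [hr]
  rcases le_abs.1 ht with h | h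
  · rw [abs_of_pos (by linarith), div_self (by linarith), erf_tail]
    simpa using tail_bound t h
  · have := tail_bound (-t) h
    have e : erf t = - erf (-t) := by rw [erf_neg]; simp
    rw [abs_of_neg (by linarith), div_neg, div_self (by linarith), e, erf_tail]
    simpa using this

lemma ga_contDiff : ContDiff ℝ (⊤ : ℕ∞) ga := by
  have h : ContDiff ℝ (⊤ : ℕ∞) (fun u : ℝ => Real.exp (-Real.pi * u ^ 2)) := by fun_prop
  exact Complex.ofRealCLM.contDiff.comp h

lemma erf_contDiff : ContDiff ℝ (⊤ : ℕ∞) erf := by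
  rw [contDiff_infty_iff_deriv]
  refine ⟨fun t => (erf_deriv t).differentiableAt, ?_⟩
  rw [show deriv erf = ga from funext fun t => (erf_deriv t).deriv]
  exact ga_contDiff

/-- the singular germ -/
def wmod (m : ℕ) (ξ : ℝ) : ℂ := if Odd m then ((Real.log |ξ| : ℝ) : ℂ) else ((ξ / |ξ| : ℝ) : ℂ)

lemma modE_pos (h : ℝ → ℂ) {ξ : ℝ} (hξ : 0 < ξ) : modE h ξ = ∫ u in Set.Ioi ξ, (u⁻¹ : ℂ) * h u := by
  have := integral_comp_mul_left_Ioi' (fun u : ℝ => (u⁻¹ : ℂ) * h u) 1 hξ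
  rw [mul_one] at this
  rw [← this, modE, ← integral_smul]
  congr 1; funext s
  have : (ξ : ℂ) ≠ 0 := by exact_mod_cast hξ.ne'
  rw [Complex.real_smul, mul_comm ξ s]
  push_cast
  rw [mul_inv]; field_simp

lemma modE_neg (h : ℝ → ℂ) (ε : ℂ) (hε : ∀ u, h (-u) = ε * h u) (ξ : ℝ) : modE h (-ξ) = ε * modE h ξ := by
  rw [modE, modE, ← integral_const_mul]
  congr 1; funext s
  rw [mul_neg, hε]; ring

/-- smooth division of the gaussian -/
def kga : ℝ → ℂ := dslope ga 0

lemma kga_eq (u : ℝ) : ga u = 1 + u * kga u := by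
  have := sub_smul_dslope ga 0 u
  rw [sub_zero, Complex.real_smul] at this
  rw [kga, this]; simp [ga]

lemma kga_neg (u : ℝ) : kga (-u) = - kga u := by
  by_cases hu : u = 0
  · subst hu
    have : kga 0 = 0 := by
      rw [kga, dslope_same]
      have := gauss_poly_deriv 1 0
      simp only [Polynomial.eval_one, one_mul] at this
      have h2 : HasDerivAt ga _ 0 := this
      rw [h2.deriv]; simp
    simp [this]
  · have h1 := kga_eq u
    have h2 := kga_eq (-u)
    rw [ga_neg, h1] at h2
    have hu' : (u : ℂ) ≠ 0 := by exact_mod_cast hu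
    have h3 : (u : ℂ) * kga u = u * (- kga (-u)) := by
      have := add_left_cancel h2
      rw [this]; push_cast; ring
    rw [mul_left_cancel₀ hu' h3]; simp

lemma kga_contDiff : ContDiff ℝ (⊤ : ℕ∞) kga := by
  rw [contDiff_iff_contDiffAt]
  intro u
  by_cases hu : u = 0
  · subst hu
    have : AnalyticAt ℝ ga 0 := by
      have h : AnalyticAt ℝ (fun u : ℝ => Real.exp (-Real.pi * u ^ 2)) 0 := by fun_prop
      exact (Complex.ofRealCLM.analyticAt _).comp h
    obtain ⟨p, hp⟩ := this
    have := hp.has_fpower_series_dslope_fslope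
    exact this.analyticAt.contDiffAt
  · have h1 : ContDiffAt ℝ (⊤ : ℕ∞) (fun u : ℝ => (u : ℂ)⁻¹ * (ga u - 1)) u := by
      refine ContDiffAt.mul (ContDiffAt.inv ?_ (by exact_mod_cast hu)) (ga_contDiff.contDiffAt.sub contDiffAt_const)
      exact Complex.ofRealCLM.contDiff.contDiffAt
    refine h1.congr_of_eventuallyEq ?_
    filter_upwards [isOpen_ne.mem_nhds hu] with v hv
    have hv' : (v : ℂ) ≠ 0 := by exact_mod_cast hv
    rw [kga_eq v]; field_simp; ring

lemma prim_contDiff {f : ℝ → ℂ} (hf : ContDiff ℝ (⊤ : ℕ∞) f) (a : ℝ) :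
    ContDiff ℝ (⊤ : ℕ∞) (fun x => ∫ v in a..x, f v) := by
  have hd : ∀ t, HasDerivAt (fun x => ∫ v in a..x, f v) (f t) t := fun t =>
    (hf.continuous.integral_hasStrictDerivAt a t).hasDerivAt
  rw [contDiff_infty_iff_deriv]
  refine ⟨fun t => (hd t).differentiableAt, ?_⟩
  rw [show deriv (fun x => ∫ v in a..x, f v) = f from funext fun t => (hd t).deriv]
  exact hf

lemma log_model {ξ : ℝ} (hξ : ξ ≠ 0) : modE ga ξ =
    ((∫ u in Set.Ioi (1:ℝ), (u⁻¹ : ℂ) * ga u) - ∫ v in (1:ℝ)..ξ, kga v) + (-1) * ((Real.log |ξ| : ℝ) : ℂ) := by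
  have hpos : ∀ ξ : ℝ, 0 < ξ → modE ga ξ =
      ((∫ u in Set.Ioi (1:ℝ), (u⁻¹ : ℂ) * ga u) - ∫ v in (1:ℝ)..ξ, kga v) + (-1) * ((Real.log |ξ| : ℝ) : ℂ) := by
    intro ξ hξ
    have hi : ∀ a : ℝ, 0 < a → IntegrableOn (fun u : ℝ => (u⁻¹ : ℂ) * ga u) (Set.Ioi a) := by
      intro a ha
      have h0 : Integrable ga := by simpa using ga_int 0
      refine Integrable.bdd_mul (c := a⁻¹) h0.integrableOn (Measurable.aestronglyMeasurable (by fun_prop)) ?_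
      rw [ae_restrict_iff' measurableSet_Ioi]
      refine ae_of_all _ fun s hs => ?_
      have hs' : a < s := hs
      rw [norm_inv, Complex.norm_real, Real.norm_of_nonneg (ha.trans hs').le]
      gcongr
    have h := intervalIntegral.integral_interval_add_Ioi (a := 1) (b := ξ) (hi 1 one_pos) (hi ξ hξ)
    rw [modE_pos _ hξ, ← h]
    have h2 : ∫ u in (1:ℝ)..ξ, (u⁻¹ : ℂ) * ga u = (∫ u in (1:ℝ)..ξ, ((u⁻¹ : ℝ) : ℂ)) + ∫ u in (1:ℝ)..ξ, kga u := by
      rw [← intervalIntegral.integral_add]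
      · refine intervalIntegral.integral_congr fun u hu => ?_
        have hu0 : 0 < u := by
          rw [Set.uIcc, Set.mem_Icc] at hu
          exact lt_of_lt_of_le (lt_min one_pos hξ) hu.1
        have hu' : (u : ℂ) ≠ 0 := by exact_mod_cast hu0.ne'
        beta_reduce
        rw [kga_eq]; push_cast; field_simp
      · apply ContinuousOn.intervalIntegrable
        intro u hu
        have hu0 : 0 < u := by
          rw [Set.uIcc, Set.mem_Icc] at hu
          exact lt_of_lt_of_le (lt_min one_pos hξ) hu.1
        apply ContinuousAt.continuousWithinAt
        exact Complex.continuous_ofReal.continuousAt.comp (continuousAt_inv₀ hu0.ne')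
      · exact kga_contDiff.continuous.intervalIntegrable _ _
    rw [h2, intervalIntegral.integral_ofReal, integral_inv_of_pos one_pos hξ, abs_of_pos hξ, div_one]
    ring
  rcases lt_or_gt_of_ne hξ with h | h
  · have h1 := hpos (-ξ) (by linarith)
    have h2 := modE_neg ga 1 (fun u => by rw [ga_neg, one_mul]) ξ
    rw [one_mul] at h2
    have hodd : ∫ v in ξ..(-ξ), kga v = 0 := by
      have := intervalIntegral.integral_comp_neg (a := ξ) (b := -ξ) kga
      simp only [kga_neg, neg_neg, intervalIntegral.integral_neg] at this
      exact self_eq_neg.1 this.symm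
    have h3 : ∫ v in (1:ℝ)..(-ξ), kga v = ∫ v in (1:ℝ)..ξ, kga v := by
      rw [← intervalIntegral.integral_add_adjacent_intervals (b := ξ)
        (kga_contDiff.continuous.intervalIntegrable _ _) (kga_contDiff.continuous.intervalIntegrable _ _),
        hodd, add_zero]
    rw [← h2, h1, h3, abs_neg]
  · exact hpos ξ h

lemma sgn_model {ξ : ℝ} (hξ : ξ ≠ 0) : modE (fun u => u * ga u) ξ =
    (- erf ξ) + (1/2) * ((ξ / |ξ| : ℝ) : ℂ) := by
  have hpos : ∀ ξ : ℝ, 0 < ξ → modE (fun u => u * ga u) ξ =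
    (- erf ξ) + (1/2) * ((ξ / |ξ| : ℝ) : ℂ) := by
    intro ξ hξ
    rw [modE_pos _ hξ, erf_tail, abs_of_pos hξ, div_self hξ.ne']
    have : ∫ u in Set.Ioi ξ, (u⁻¹ : ℂ) * (u * ga u) = ∫ u in Set.Ioi ξ, ga u := by
      refine setIntegral_congr_fun measurableSet_Ioi fun u hu => ?_
      have hu' : (u : ℂ) ≠ 0 := by exact_mod_cast (hξ.trans hu).ne'
      beta_reduce; field_simp
    rw [this]; push_cast; ring
  rcases lt_or_gt_of_ne hξ with h | h
  · have h1 := hpos (-ξ) (by linarith)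
    have h2 := modE_neg (fun u => u * ga u) (-1) (fun u => by rw [ga_neg]; push_cast; ring) ξ
    rw [h1, erf_neg, abs_neg] at h2
    have : modE (fun u => u * ga u) ξ = - (-1 * modE (fun u => u * ga u) ξ) := by ring
    rw [this, ← h2]; push_cast; ring
  · exact hpos ξ h

lemma sgn_pow {t : ℝ} (ht : t ≠ 0) (m : ℕ) : (t / |t|) ^ m = if Odd m then t / |t| else 1 := by
  have h2 : (t / |t|) ^ 2 = 1 := by rw [div_pow, sq_abs, div_self (pow_ne_zero _ ht)]
  split_ifs with h
  · obtain ⟨k, rfl⟩ := h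
    rw [pow_succ, pow_mul, h2, one_pow, one_mul]
  · rw [Nat.not_odd_iff_even] at h
    obtain ⟨k, rfl⟩ := h
    rw [← two_mul, pow_mul, h2, one_pow]

lemma model_exists (m : ℕ) : ∃ (e A : ℝ → ℂ) (b κ : ℂ), κ ≠ 0 ∧
    (∀ j : ℕ, Integrable (fun ξ : ℝ => (ξ : ℂ) ^ j * e ξ)) ∧ ContDiff ℝ (⊤ : ℕ∞) A ∧
    (∀ ξ : ℝ, ξ ≠ 0 → e ξ = A ξ + b * wmod m ξ) ∧
    ∀ j : ℕ, RD (fun t => (-(2 * Real.pi * Complex.I)) ^ j * chF volume (fun x : ℝ => x) (fun ξ : ℝ => (ξ : ℂ) ^ j * e ξ) t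
      - (-1) ^ j * j.factorial * κ * (((t / |t|) ^ m : ℝ) : ℂ) / (t : ℂ) ^ (j + 1)) := by
  have hpi : (Real.pi : ℂ) ≠ 0 := by exact_mod_cast Real.pi_ne_zero
  by_cases hm : Odd m
  · have hI := modE_integrable ga_cont ga_int
    refine ⟨modE ga, fun ξ => (∫ u in Set.Ioi (1:ℝ), (u⁻¹ : ℂ) * ga u) - ∫ v in (1:ℝ)..ξ, kga v, -1, 1/2, by norm_num, hI, ?_, fun ξ hξ => ?_, ?_⟩
    rotate_left
    · rw [log_model hξ, wmod, if_pos hm]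
    · intro j
      obtain ⟨T, hT0, hT, hTR⟩ := gauss_tower 1 erf (fun t => by simpa [ga] using erf_deriv t)
      have := expand_tower (fun j t => (-(2 * Real.pi * Complex.I)) ^ j * chF volume (fun x : ℝ => x) (fun ξ : ℝ => (ξ : ℂ) ^ j * modE ga ξ) t)
        T (chF_tower measurable_id hI) hT (fun t => by
          have := modE_chF ga_cont ga_int ga_chF erf_deriv (by simp [erf]) t
          simpa [hT0] using this) (1/2) (fun t => (((t / |t|) ^ m : ℝ) : ℂ)) (by
            refine erf_RD.mono fun t ht => le_of_eq ?_
            have ht0 : t ≠ 0 := by rintro rfl; norm_num at ht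
            rw [sgn_pow ht0, if_pos hm, hT0]) hTR j
      exact this
    · exact contDiff_const.sub (prim_contDiff kga_contDiff 1)
  · have hc : Continuous (fun u : ℝ => (u:ℂ) * ga u) := by have := ga_cont; fun_prop
    have hint : ∀ j : ℕ, Integrable (fun u : ℝ => (u:ℂ) ^ j * ((u:ℂ) * ga u)) := fun j => by
      refine (ga_int (j+1)).congr (ae_of_all _ fun u => ?_)
      beta_reduce; ring
    have hI := modE_integrable hc hint
    have hder : ∀ t : ℝ, HasDerivAt ga (-2 * Real.pi * t * ga t) t := fun t => by
      have h := gauss_poly_deriv 1 t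
      simp only [Polynomial.eval_one, one_mul] at h
      have h2 : HasDerivAt ga _ t := h
      refine h2.congr_deriv ?_
      simp [ga]
    have hch : ∀ t, chF volume (fun x => x) (fun u : ℝ => (u:ℂ) * ga u) t = - Complex.I * t * ga t := by
      intro t
      have h1 := chF_hasDerivAt (μ := volume) (q := fun x : ℝ => x) measurable_id (by simpa using ga_int 0) (by simpa using ga_int 1) t
      rw [show chF volume (fun x => x) ga = ga from funext ga_chF] at h1
      have h2 := h1.unique (hder t)
      have h3 : (-(2 * Real.pi * Complex.I)) ≠ 0 := by simp [hpi]
      apply mul_left_cancel₀ h3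
      rw [h2]; linear_combination (-2 * Real.pi * t * ga t) * Complex.I_sq
    set K : ℝ → ℂ := fun t => -(Complex.I / (2 * Real.pi)) * (1 - ga t) with hK
    have hKd : ∀ t, HasDerivAt K (- Complex.I * t * ga t) t := by
      intro t
      refine (((hder t).const_sub 1).const_mul (-(Complex.I / (2 * Real.pi)))).congr_deriv ?_
      field_simp
    refine ⟨modE (fun u => u * ga u), _, 1/2, -(Complex.I / (2 * Real.pi)), by simp [hpi], hI, erf_contDiff.neg, fun ξ hξ => ?_, ?_⟩
    · rw [sgn_model hξ, wmod, if_neg hm]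
    · intro j
      obtain ⟨T, hT0, hT, hTR⟩ := gauss_tower (Polynomial.C (- Complex.I) * Polynomial.X) K (fun t => by simpa [ga] using hKd t)
      have := expand_tower (fun j t => (-(2 * Real.pi * Complex.I)) ^ j * chF volume (fun x : ℝ => x) (fun ξ : ℝ => (ξ : ℂ) ^ j * modE (fun u => u * ga u) ξ) t)
        T (chF_tower measurable_id hI) hT (fun t => by
          have := modE_chF hc hint hch hKd (by simp [hK, ga]) t
          simpa [hT0] using this) (-(Complex.I / (2 * Real.pi))) (fun t => (((t / |t|) ^ m : ℝ) : ℂ)) (by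
            refine (RD_gauss (Polynomial.C (Complex.I / (2 * Real.pi)))).mono fun t ht => le_of_eq ?_
            have ht0 : t ≠ 0 := by rintro rfl; norm_num at ht
            rw [sgn_pow ht0, if_neg hm, hT0, hK, Polynomial.eval_C]
            simp only [ga]
            congr 1
            push_cast; ring) hTR j
      exact this

section chFsmooth
variable {X : Type*} [MeasurableSpace X] {μ : Measure X} {q : X → ℝ}

lemma chF_contDiff (hq : Measurable q) (n : ℕ) : ∀ {φ : X → ℂ},
    (∀ k ≤ n, Integrable (fun x => (q x : ℂ) ^ k * φ x) μ) → ContDiff ℝ n (chF μ q φ) := by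
  induction n with
  | zero =>
    intro φ h
    have h0 : Integrable φ μ := by simpa using h 0 le_rfl
    exact contDiff_zero.2 (chF_continuous hq h0)
  | succ n ih =>
    intro φ h
    have h0 : Integrable φ μ := by simpa using h 0 (Nat.zero_le _)
    have h1 : Integrable (fun x => (q x : ℂ) * φ x) μ := by simpa using h 1 (by omega)
    have hd := chF_hasDerivAt hq h0 h1
    push_cast
    rw [contDiff_succ_iff_deriv]
    refine ⟨fun t => (hd t).differentiableAt, by simp, ?_⟩
    rw [funext fun t => (hd t).deriv]
    refine contDiff_const.mul (ih fun k hk => ?_)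
    refine (h (k+1) (by omega)).congr (ae_of_all _ fun x => ?_)
    ring

lemma chF_iteratedDeriv (hq : Measurable q) (n : ℕ) : ∀ {φ : X → ℂ},
    (∀ k ≤ n, Integrable (fun x => (q x : ℂ) ^ k * φ x) μ) → 
    iteratedDeriv n (chF μ q φ) = fun t => (-(2 * Real.pi * Complex.I)) ^ n * chF μ q (fun x => (q x : ℂ) ^ n * φ x) t := by
  induction n with
  | zero => intro φ h; simp
  | succ n ih =>
    intro φ h
    have h0 : Integrable φ μ := by simpa using h 0 (Nat.zero_le _)
    have h1 : Integrable (fun x => (q x : ℂ) * φ x) μ := by simpa using h 1 (by omega)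
    have hd := chF_hasDerivAt hq h0 h1
    have h2 : ∀ k ≤ n, Integrable (fun x => (q x : ℂ) ^ k * ((q x : ℂ) * φ x)) μ := fun k hk => by
      refine (h (k+1) (by omega)).congr (ae_of_all _ fun x => ?_)
      ring
    rw [iteratedDeriv_succ', funext fun t => (hd t).deriv]
    have hcd : ContDiff ℝ n (chF μ q (fun x => (q x : ℂ) * φ x)) := chF_contDiff hq n h2
    funext t
    rw [iteratedDeriv_const_mul_field, ih h2, pow_succ']
    have : (fun x => (q x : ℂ) ^ n * ((q x : ℂ) * φ x)) = fun x => (q x : ℂ) ^ (n+1) * φ x := by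
      funext x; ring
    rw [this]; ring
end chFsmooth

/-- inverse Fourier transform -/
def ift (R : ℝ → ℂ) (u : ℝ) : ℂ := ∫ t : ℝ, Complex.exp ((2 * Real.pi * t * u : ℝ) * Complex.I) * R t

lemma ift_eq (R : ℝ → ℂ) : ift R = fun u => chF volume (fun x : ℝ => x) R (-u) := by
  funext u
  rw [ift, chF]
  congr 1; funext t
  congr 2; push_cast; ring

lemma integrable_of_decay {f : ℝ → ℂ} (hf : Continuous f) {C : ℝ} (h : ∀ t : ℝ, 1 ≤ |t| → ‖f t‖ * |t| ^ 2 ≤ C) :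
    Integrable f := by
  obtain ⟨M, hM⟩ := (isCompact_Icc (a := (-1:ℝ)) (b := 1)).exists_bound_of_continuousOn hf.continuousOn
  refine Integrable.mono' (g := fun t => (2 * (|M| + |C|)) * (1 + t^2)⁻¹) (integrable_inv_one_add_sq.const_mul _)
    hf.aestronglyMeasurable (ae_of_all _ fun t => ?_)
  have h1 : 0 < 1 + t^2 := by positivity
  rw [← div_eq_mul_inv, le_div_iff₀ h1]
  rcases le_total 1 |t| with ht | ht
  · have := h t ht
    rw [sq_abs] at this
    have h2 : 1 ≤ t^2 := by rw [← sq_abs]; nlinarith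
    nlinarith [norm_nonneg (f t), le_abs_self C, abs_nonneg M, mul_le_mul_of_nonneg_left h2 (norm_nonneg (f t))]
  · have h3 := hM t (abs_le.1 ht)
    have h2 : t^2 ≤ 1 := by rw [← sq_abs]; nlinarith [abs_nonneg t]
    nlinarith [norm_nonneg (f t), le_abs_self M, abs_nonneg C, mul_le_mul_of_nonneg_left h2 (norm_nonneg (f t))]

lemma integrable_pow_of_decay {f : ℝ → ℂ} (hf : Continuous f) {n : ℕ} {C : ℝ}
    (h : ∀ t : ℝ, 1 ≤ |t| → ‖f t‖ * |t| ^ (n+2) ≤ C) (k : ℕ) (hk : k ≤ n) :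
    Integrable (fun t : ℝ => (t : ℂ) ^ k * f t) := by
  refine integrable_of_decay (C := C) (by fun_prop) fun t ht => le_trans ?_ (h t ht)
  rw [norm_mul, norm_pow, Complex.norm_real, Real.norm_eq_abs]
  calc |t| ^ k * ‖f t‖ * |t|^2 = ‖f t‖ * |t| ^ (k+2) := by ring
    _ ≤ _ := by gcongr

lemma ift_contDiff {f : ℝ → ℂ} (n : ℕ) (h : ∀ k ≤ n, Integrable (fun t : ℝ => (t : ℂ) ^ k * f t)) :
    ContDiff ℝ n (ift f) := by
  rw [ift_eq]
  exact (chF_contDiff measurable_id n h).comp contDiff_neg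

lemma ift_bounded {f : ℝ → ℂ} (n : ℕ) (h : ∀ k ≤ n, Integrable (fun t : ℝ => (t : ℂ) ^ k * f t)) :
    ∃ C : ℝ, ∀ ξ, ‖iteratedDeriv n (ift f) ξ‖ ≤ C := by
  refine ⟨(2 * Real.pi) ^ n * ∫ t : ℝ, ‖(t : ℂ) ^ n * f t‖, fun ξ => ?_⟩
  rw [ift_eq, iteratedDeriv_comp_neg n, chF_iteratedDeriv (q := fun x : ℝ => x) measurable_id n h, norm_smul, norm_mul]
  simp only [norm_pow, norm_neg, norm_one, one_pow, one_mul, norm_mul, Complex.norm_I, mul_one, Complex.norm_real,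
    Real.norm_of_nonneg Real.pi_pos.le, Complex.norm_ofNat]
  gcongr
  have := chF_norm_le (μ := volume) (q := fun x : ℝ => x) (φ := fun t : ℝ => (t:ℂ) ^ n * f t) (-ξ)
  simpa using this

lemma smooth_rep {g : ℝ → ℂ} (hg : ContDiff ℝ (⊤ : ℕ∞) g) (hc : HasCompactSupport g) :
    Integrable (chF volume (fun x : ℝ => x) g) ∧
      ∀ u, g u = ∫ t : ℝ, Complex.exp ((2 * Real.pi * t * u : ℝ) * Complex.I) * chF volume (fun x : ℝ => x) g t := by
  let s : SchwartzMap ℝ ℂ := hc.toSchwartzMap hg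
  have hs : (s : ℝ → ℂ) = g := rfl
  have hF : chF volume (fun x : ℝ => x) g = FourierTransform.fourier g := by
    funext t
    rw [Real.fourier_real_eq_integral_exp_smul, chF]
    congr 1; funext x
    rw [smul_eq_mul]; congr 2; push_cast; ring
  have hFi : Integrable (FourierTransform.fourier g) := by
    rw [← hs, ← SchwartzMap.fourier_coe]
    exact (FourierTransform.fourier s).integrable
  refine ⟨hF ▸ hFi, fun u => ?_⟩
  have := congrFun (hg.continuous.fourierInv_fourier_eq (hg.continuous.integrable_of_hasCompactSupport hc) hFi) u
  rw [← this, Real.fourierInv_eq', hF]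
  congr 1; funext t
  rw [smul_eq_mul]; congr 2
  simp; ring

lemma pairing_split {X : Type*} [MeasurableSpace X] {μ : Measure X} [SFinite μ] {q : X → ℝ} {φ : X → ℂ}
    (hq : Measurable q) (hφ : Integrable φ μ) {e R : ℝ → ℂ} (he : Integrable e) (hR : Integrable R)
    (hF : ∀ t, chF μ q φ t = chF volume (fun x : ℝ => x) e t + R t) {g : ℝ → ℂ}
    (hg : ContDiff ℝ (⊤ : ℕ∞) g) (hc : HasCompactSupport g) :
    ∫ x, g (q x) * φ x ∂μ = ∫ ξ, g ξ * (e ξ + ift R ξ) := by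
  obtain ⟨hgi, hgr⟩ := smooth_rep hg hc
  set gh := chF volume (fun x : ℝ => x) g with hgh
  have hgI : Integrable g := hg.continuous.integrable_of_hasCompactSupport hc
  obtain ⟨M, hM⟩ := hg.continuous.bounded_above_of_compact_support hc
  have hghc : Continuous gh := chF_continuous measurable_id hgI
  have hghb : ∀ t, ‖gh t‖ ≤ ∫ x, ‖g x‖ := fun t => chF_norm_le t
  rw [chF_pairing hq hφ hgi hgr]
  have h1 := chF_pairing (μ := volume) (q := fun x : ℝ => x) measurable_id he hgi hgr
  have h2 := chF_pairing (μ := volume) (q := fun x : ℝ => x) (g := ift R) measurable_id hgI hR (fun u => rfl)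
  have hiR : Integrable (fun t => gh t * R (-t)) :=
    Integrable.bdd_mul hR.comp_neg hghc.aestronglyMeasurable (ae_of_all _ hghb)
  have hie : Integrable (fun t => gh t * chF volume (fun x : ℝ => x) e (-t)) := by
    refine Integrable.mul_bdd (c := ∫ x, ‖e x‖) hgi ?_ (ae_of_all _ fun t => chF_norm_le _)
    exact ((chF_continuous measurable_id he).comp continuous_neg).aestronglyMeasurable
  have hge : Integrable (fun ξ => g ξ * e ξ) :=
    Integrable.bdd_mul he hg.continuous.aestronglyMeasurable (ae_of_all _ hM)
  have hiftc : Continuous (ift R) := by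
    rw [ift_eq]; exact (chF_continuous measurable_id hR).comp continuous_neg
  have hgR : Integrable (fun ξ => g ξ * ift R ξ) :=
    Integrable.mul_bdd (c := ∫ x, ‖R x‖) hgI hiftc.aestronglyMeasurable (ae_of_all _ fun t => by
      rw [ift_eq]; exact chF_norm_le _)
  simp_rw [hF, mul_add]
  rw [integral_add hie hiR, integral_add hge hgR, h1]
  congr 1
  calc ∫ t, gh t * R (-t) = ∫ t, gh (-t) * R t := by
        rw [← integral_neg_eq_self]; simp
    _ = ∫ t, R t * gh (-t) := by simp_rw [mul_comm]
    _ = ∫ ξ, ift R ξ * g ξ := h2.symm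
    _ = _ := by simp_rw [mul_comm]

lemma supp_integrable {f : ℝ → ℂ} (hf : ContinuousOn f ({0}ᶜ : Set ℝ)) {g : ℝ → ℝ} (hg : Continuous g)
    (hc : HasCompactSupport g) (hs : tsupport g ⊆ ({0}ᶜ : Set ℝ)) : Integrable (fun x => g x • f x) := by
  have h1 : ContinuousOn (fun x => g x • f x) ({0}ᶜ : Set ℝ) := hg.continuousOn.smul hf
  have hs' : tsupport (fun x => g x • f x) ⊆ tsupport g := closure_mono (Function.support_smul_subset_left g f)
  have h2 : Continuous (fun x => g x • f x) := h1.continuous_of_tsupport_subset isOpen_compl_singleton (hs'.trans hs)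
  exact h2.integrable_of_hasCompactSupport hc.smul_right

lemma uniq_off {f₁ f₂ : ℝ → ℂ} (h₁ : ContinuousOn f₁ ({0}ᶜ : Set ℝ)) (h₂ : ContinuousOn f₂ ({0}ᶜ : Set ℝ))
    (h : ∀ g : ℝ → ℝ, ContDiff ℝ (⊤ : ℕ∞) g → HasCompactSupport g → tsupport g ⊆ ({0}ᶜ : Set ℝ) →
      ∫ x, (g x : ℂ) * f₁ x = ∫ x, (g x : ℂ) * f₂ x) : Set.EqOn f₁ f₂ ({0}ᶜ : Set ℝ) := by
  have hU : IsOpen ({0}ᶜ : Set ℝ) := isOpen_compl_singleton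
  have key := hU.ae_eq_zero_of_integral_contDiff_smul_eq_zero (μ := volume) (f := fun x => f₁ x - f₂ x)
    ((h₁.sub h₂).locallyIntegrableOn hU.measurableSet) (fun g hg hgc hgs => by
      simp_rw [smul_sub]
      rw [integral_sub (supp_integrable h₁ hg.continuous hgc hgs) (supp_integrable h₂ hg.continuous hgc hgs), sub_eq_zero]
      simpa only [Complex.real_smul] using h g hg hgc hgs)
  refine Measure.eqOn_open_of_ae_eq (μ := volume) ?_ hU h₁ h₂
  rw [EventuallyEq, ae_restrict_iff' hU.measurableSet]
  filter_upwards [key] with x hx hxu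
  exact sub_eq_zero.1 (hx hxu)

lemma pairing_continuous {X : Type*} [MeasurableSpace X] {μ : Measure X} {q : X → ℝ} {φ : X → ℂ}
    (hq : Measurable q) (hφ : Integrable φ μ) {f : ℝ → ℂ} (hf : LocallyIntegrable f)
    (h : ∀ g : ℝ → ℂ, ContDiff ℝ (⊤ : ℕ∞) g → HasCompactSupport g → ∫ x, g (q x) * φ x ∂μ = ∫ ξ, g ξ * f ξ)
    {g : ℝ → ℂ} (hg : Continuous g) (hc : HasCompactSupport g) :
    ∫ x, g (q x) * φ x ∂μ = ∫ ξ, g ξ * f ξ := by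
  have hap : ∀ n : ℕ, ∃ k : ℝ → ℂ, ContDiff ℝ (⊤ : ℕ∞) k ∧ (∀ x, dist (k x) (g x) < 1 / ((n : ℝ) + 1)) ∧
      Function.support k ⊆ Function.support g := fun n =>
    hg.exists_contDiff_approx (ε := fun _ => 1 / ((n : ℝ) + 1)) ⊤ continuous_const (fun _ => by positivity)
  choose k hk1 hk2 hk3 using hap
  have hkc : ∀ n, HasCompactSupport (k n) := fun n => hc.mono (hk3 n)
  have hlim : ∀ u, Tendsto (fun n => k n u) atTop (nhds (g u)) := by
    intro u
    rw [tendsto_iff_dist_tendsto_zero]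
    exact squeeze_zero (fun _ => dist_nonneg) (fun n => (hk2 n u).le) tendsto_one_div_add_atTop_nhds_zero_nat
  obtain ⟨M, hM⟩ := hg.bounded_above_of_compact_support hc
  have hkb : ∀ n u, ‖k n u‖ ≤ M + 1 := by
    intro n u
    have h1 := (hk2 n u).le
    rw [dist_eq_norm] at h1
    have h2 : 1 / ((n : ℝ) + 1) ≤ 1 := by
      rw [div_le_one (by positivity)]; linarith [n.cast_nonneg (α := ℝ)]
    calc ‖k n u‖ = ‖(k n u - g u) + g u‖ := by ring_nf
      _ ≤ _ := norm_add_le _ _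
      _ ≤ _ := by linarith [hM u]
  have hL : Tendsto (fun n => ∫ x, k n (q x) * φ x ∂μ) atTop (nhds (∫ x, g (q x) * φ x ∂μ)) := by
    refine tendsto_integral_of_dominated_convergence (fun x => (M + 1) * ‖φ x‖) ?_ (hφ.norm.const_mul _) ?_ ?_
    · intro n
      exact ((hk1 n).continuous.measurable.comp hq).aestronglyMeasurable.mul hφ.aestronglyMeasurable
    · intro n
      refine ae_of_all _ fun x => ?_
      rw [norm_mul]; gcongr; exact hkb n _
    · exact ae_of_all _ fun x => (hlim _).mul_const _
  have hR : Tendsto (fun n => ∫ ξ, k n ξ * f ξ) atTop (nhds (∫ ξ, g ξ * f ξ)) := by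
    have hfi : IntegrableOn f (tsupport g) := hf.integrableOn_isCompact hc
    have hms : MeasurableSet (tsupport g) := (isClosed_tsupport g).measurableSet
    refine tendsto_integral_of_dominated_convergence (fun x => (M + 1) * ‖(tsupport g).indicator f x‖) ?_ 
      ((hfi.integrable_indicator hms).norm.const_mul _) ?_ ?_
    · intro n
      exact (hk1 n).continuous.aestronglyMeasurable.mul hf.aestronglyMeasurable
    · intro n
      refine ae_of_all _ fun x => ?_
      by_cases hx : x ∈ tsupport g
      · rw [Set.indicator_of_mem hx, norm_mul]; gcongr; exact hkb n _
      · have : k n x = 0 := by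
          by_contra hne
          exact hx (subset_tsupport g (hk3 n hne))
        rw [Set.indicator_of_notMem hx, this]; simp
    · exact ae_of_all _ fun x => (hlim _).mul_const _
  refine tendsto_nhds_unique hL ?_
  simp_rw [fun n => h (k n) (hk1 n) (hkc n)]
  exact hR

lemma taylor_bound {G : ℝ → ℂ} (hG : ContDiff ℝ (⊤ : ℕ∞) G) : ∃ a : ℕ → ℂ, ∀ n : ℕ, ∃ C : ℝ, ∀ s : ℝ, |s| ≤ 1 →
    ‖G s - ∑ i ∈ Finset.range n, a i * (s : ℂ) ^ i‖ ≤ C * |s| ^ n := by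
  refine ⟨fun i => ((i.factorial : ℝ)⁻¹ : ℂ) * iteratedDerivWithin i G Set.univ 0, fun n => ?_⟩
  set a : ℕ → ℂ := fun i => ((i.factorial : ℝ)⁻¹ : ℂ) * iteratedDerivWithin i G Set.univ 0 with ha
  have h1 := taylor_isLittleO_univ (x₀ := 0) (n := n) (hG.of_le (by exact_mod_cast le_top))
  have h2 := h1.bound one_pos
  have hsum : ∀ s : ℝ, taylorWithinEval G n Set.univ 0 s = ∑ i ∈ Finset.range (n+1), a i * (s : ℂ) ^ i := by
    intro s
    rw [taylor_within_apply]
    refine Finset.sum_congr rfl fun i _ => ?_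
    rw [Complex.real_smul, ha]; push_cast; rw [sub_zero]; ring
  obtain ⟨δ, hδ, hb⟩ := Metric.eventually_nhds_iff.1 h2
  set E : ℝ → ℂ := fun s => G s - ∑ i ∈ Finset.range n, a i * (s : ℂ) ^ i with hE
  have hEc : Continuous E := by
    have := hG.continuous
    fun_prop
  obtain ⟨M, hM⟩ := (isCompact_Icc (a := (-1:ℝ)) (b := 1)).exists_bound_of_continuousOn hEc.continuousOn
  have hM0 : 0 ≤ M := (norm_nonneg _).trans (hM 0 (by norm_num))
  refine ⟨(1 + ‖a n‖) + M / δ ^ n, fun s hs => ?_⟩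
  have hMd : 0 ≤ M / δ ^ n := by positivity
  change ‖E s‖ ≤ _
  rcases lt_or_ge |s| δ with h | h
  · have := hb (y := s) (by rwa [Real.dist_eq, sub_zero])
    rw [hsum, Finset.sum_range_succ, sub_zero, one_mul] at this
    have h3 : E s = (G s - (∑ i ∈ Finset.range n, a i * (s : ℂ) ^ i + a n * (s : ℂ) ^ n)) + a n * (s : ℂ) ^ n := by
      simp only [hE]; ring
    rw [h3]
    refine (norm_add_le _ _).trans ?_
    rw [norm_mul (a n), norm_pow, Complex.norm_real, Real.norm_eq_abs]
    rw [norm_pow, Real.norm_eq_abs] at this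
    have h4 : 0 ≤ M / δ ^ n * |s| ^ n := by positivity
    linarith
  · have h5 := hM s (abs_le.1 hs)
    have h6 : δ ^ n ≤ |s| ^ n := pow_le_pow_left₀ hδ.le h n
    have h7 : M ≤ M / δ ^ n * |s| ^ n := by
      rw [div_mul_eq_mul_div, le_div_iff₀ (by positivity)]; gcongr
    have h8 : 0 ≤ (1 + ‖a n‖) * |s|^n := by positivity
    linarith

lemma pow_mul_contDiff {w : ℝ → ℂ} {c : ℂ} (hc : Continuous (fun x : ℝ => (x:ℂ) * w x))
    (hd : ∀ x : ℝ, x ≠ 0 → HasDerivAt w (c / x) x) (n : ℕ) :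
    ContDiff ℝ n (fun x : ℝ => (x:ℂ) ^ (n+1) * w x) := by
  induction n with
  | zero => simpa using hc
  | succ n ih =>
    have hder : ∀ x : ℝ, HasDerivAt (fun x : ℝ => (x:ℂ) ^ (n+2) * w x) 
        ((n + 2) * ((x:ℂ) ^ (n+1) * w x) + c * (x:ℂ) ^ (n+1)) x := by
      intro x
      by_cases hx : x = 0
      · subst hx
        rw [hasDerivAt_iff_tendsto_slope]
        have h1 : Tendsto (fun x : ℝ => (x:ℂ) ^ (n+1) * w x) (nhds 0) (nhds 0) := by
          have := ih.continuous.tendsto 0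
          simpa using this
        have h2 := h1.mono_left (nhdsWithin_le_nhds (s := ({0}ᶜ : Set ℝ)))
        have h3 : ((n + 2) * (((0:ℝ):ℂ) ^ (n+1) * w 0) + c * ((0:ℝ):ℂ) ^ (n+1)) = 0 := by simp
        rw [h3]
        refine h2.congr' ?_
        filter_upwards [self_mem_nhdsWithin] with y hy
        have hy' : (y:ℂ) ≠ 0 := by exact_mod_cast hy
        rw [slope_def_module]
        simp
        field_simp
        ring
      · have hx' : (x:ℂ) ≠ 0 := by exact_mod_cast hx
        have h1 : HasDerivAt (fun x : ℝ => (x:ℂ) ^ (n+2)) (((n+2 : ℕ):ℂ) * (x:ℂ)^(n+1)) x :=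
          (hasDerivAt_pow (n+2) (x:ℂ)).comp_ofReal
        refine (h1.mul (hd x hx)).congr_deriv ?_
        push_cast; field_simp; ring
    push_cast
    rw [contDiff_succ_iff_deriv]
    refine ⟨fun t => (hder t).differentiableAt, by simp, ?_⟩
    rw [show deriv (fun x : ℝ => (x:ℂ) ^ (n+1+1) * w x) = _ from funext fun t => (hder t).deriv]
    refine (contDiff_const.mul ih).add (contDiff_const.mul (Complex.ofRealCLM.contDiff.pow _))

lemma wmod_contDiff (m n : ℕ) : ContDiff ℝ n (fun x : ℝ => (x:ℂ) ^ (n+1) * wmod m x) := by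
  by_cases hm : Odd m
  · have hw : wmod m = fun x => ((Real.log x : ℝ) : ℂ) := by
      funext x; rw [wmod, if_pos hm, Real.log_abs]
    rw [hw]
    refine pow_mul_contDiff (c := 1) ?_ ?_ n
    · have := Complex.continuous_ofReal.comp Real.continuous_mul_log
      refine this.congr fun x => ?_
      simp
    · intro x hx
      exact (Real.hasDerivAt_log hx).ofReal_comp.congr_deriv (by simp)
  · have hw : wmod m = fun x => ((x / |x| : ℝ) : ℂ) := by
      funext x; rw [wmod, if_neg hm]
    rw [hw]
    refine pow_mul_contDiff (c := 0) ?_ ?_ n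
    · have := Complex.continuous_ofReal.comp (continuous_abs (G := ℝ))
      refine this.congr fun x => ?_
      by_cases hx : x = 0
      · simp [hx]
      · simp only [Function.comp]
        rw [← Complex.ofReal_mul]
        congr 1
        have : |x| ≠ 0 := abs_ne_zero.2 hx
        field_simp
        exact (sq_abs x)
    · intro x hx
      rw [zero_div]
      rcases lt_or_gt_of_ne hx with h | h
      · refine (hasDerivAt_const x (-1 : ℂ)).congr_of_eventuallyEq ?_
        filter_upwards [isOpen_Iio.mem_nhds h] with y hy
        have : y < 0 := hy
        rw [abs_of_neg this, div_neg, div_self this.ne]; simp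
      · refine (hasDerivAt_const x (1 : ℂ)).congr_of_eventuallyEq ?_
        filter_upwards [isOpen_Ioi.mem_nhds h] with y hy
        have : 0 < y := hy
        rw [abs_of_pos this, div_self this.ne']; simp

lemma wmod_contDiffAt (m n : ℕ) {x : ℝ} (hx : x ≠ 0) : ContDiffAt ℝ n (wmod m) x := by
  have h1 : ContDiffAt ℝ n (fun x : ℝ => ((x:ℂ) ^ (n+1))⁻¹ * ((x:ℂ) ^ (n+1) * wmod m x)) x := by
    refine ContDiffAt.mul (ContDiffAt.inv ?_ ?_) (wmod_contDiff m n).contDiffAt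
    · exact (Complex.ofRealCLM.contDiff.pow _).contDiffAt
    · exact pow_ne_zero _ (by exact_mod_cast hx)
  refine h1.congr_of_eventuallyEq ?_
  filter_upwards [isOpen_ne.mem_nhds hx] with y hy
  have hy' : (y:ℂ) ≠ 0 := by exact_mod_cast hy
  field_simp

lemma decay_of_quot {f u : ℝ → ℂ} (N k : ℕ) (hu : ContDiff ℝ k u)
    (hb : ∀ i ≤ k, ∃ C : ℝ, ∀ ξ, ‖iteratedDeriv i u ξ‖ ≤ C)
    (hf : ∀ ξ : ℝ, ξ ≠ 0 → (ξ : ℂ) ^ (N+1) * f ξ = u ξ) :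
    Tendsto (fun ξ : ℝ => |ξ| ^ N * ‖iteratedDeriv k f ξ‖) (cocompact ℝ) (nhds 0) := by
  choose! C hC using hb
  set K : ℤ := -((N+1 : ℕ) : ℤ) with hK
  set s : Set ℝ := {0}ᶜ with hs
  have hso : IsOpen s := isOpen_compl_singleton
  have hz : ContDiffOn ℝ k (fun x : ℝ => x ^ K) s := fun x hx => by
    have h1 : ContDiffAt ℝ k (fun x : ℝ => (x ^ (N+1))⁻¹) x :=
      ContDiffAt.inv (contDiff_id.pow _).contDiffAt (pow_ne_zero _ hx)
    refine (h1.congr_of_eventuallyEq (Eventually.of_forall fun y => ?_)).contDiffWithinAt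
    simp only [hK, zpow_neg, zpow_natCast]
  set P : ℕ → ℝ := fun i => |∏ j ∈ Finset.range i, ((K : ℝ) - j)| with hP
  have hmain : ∀ ξ : ℝ, 1 ≤ |ξ| → |ξ| ^ N * ‖iteratedDeriv k f ξ‖ ≤
      (∑ i ∈ Finset.range (k + 1), (k.choose i : ℝ) * P i * C (k - i)) * |ξ|⁻¹ := by
    intro ξ hξ
    have hξ0 : ξ ≠ 0 := by rintro rfl; norm_num at hξ
    have hξp : 0 < |ξ| := abs_pos.2 hξ0
    have hbd := norm_iteratedFDerivWithin_smul_le hz hu.contDiffOn hso.uniqueDiffOn (x := ξ) hξ0 (n := k) le_rfl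
    have he : iteratedDeriv k f ξ = iteratedDeriv k (fun y : ℝ => y ^ K • u y) ξ := by
      apply Filter.EventuallyEq.iteratedDeriv_eq
      filter_upwards [isOpen_ne.mem_nhds hξ0] with y hy
      have hy' : (y:ℂ) ≠ 0 := by exact_mod_cast hy
      rw [← hf y hy, Complex.real_smul, hK, zpow_neg, zpow_natCast]
      push_cast
      field_simp
    rw [he, ← norm_iteratedFDeriv_eq_norm_iteratedDeriv, ← iteratedFDerivWithin_of_isOpen k hso hξ0]
    calc _ ≤ |ξ|^N * ∑ i ∈ Finset.range (k + 1), (k.choose i : ℝ) * ‖iteratedFDerivWithin ℝ i (fun x : ℝ => x ^ K) s ξ‖ *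
        ‖iteratedFDerivWithin ℝ (k - i) u s ξ‖ := by gcongr
      _ ≤ |ξ|^N * ∑ i ∈ Finset.range (k + 1), ((k.choose i : ℝ) * P i * C (k - i)) * (|ξ|^(N+1))⁻¹ := by
        refine mul_le_mul_of_nonneg_left (Finset.sum_le_sum fun i hi => ?_) (by positivity)
        have hik : i ≤ k := by simp at hi; omega
        rw [iteratedFDerivWithin_of_isOpen i hso hξ0, iteratedFDerivWithin_of_isOpen (k-i) hso hξ0,
          norm_iteratedFDeriv_eq_norm_iteratedDeriv, norm_iteratedFDeriv_eq_norm_iteratedDeriv,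
          iteratedDeriv_eq_iterate, iter_deriv_zpow', norm_mul, Real.norm_eq_abs, Real.norm_eq_abs]
        have h1 : |ξ ^ (K - i)| ≤ (|ξ|^(N+1))⁻¹ := by
          rw [abs_zpow, ← zpow_natCast, ← zpow_neg]
          apply zpow_le_zpow_right₀ hξ
          rw [hK]; omega
        have h2 := hC (k-i) (by omega) ξ
        calc _ ≤ (k.choose i : ℝ) * (P i * (|ξ|^(N+1))⁻¹) * C (k-i) := by gcongr
          _ = _ := by ring
      _ = _ := by
        rw [← Finset.sum_mul]
        rw [pow_succ]
        field_simp
  have hlim : Tendsto (fun ξ : ℝ => (∑ i ∈ Finset.range (k + 1), (k.choose i : ℝ) * P i * C (k - i)) * |ξ|⁻¹)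
      (cocompact ℝ) (nhds 0) := by
    have h1 : Tendsto (fun ξ : ℝ => |ξ|⁻¹) (cocompact ℝ) (nhds 0) := 
      tendsto_inv_atTop_zero.comp (tendsto_norm_cocompact_atTop (E := ℝ))
    simpa using h1.const_mul (∑ i ∈ Finset.range (k + 1), (k.choose i : ℝ) * P i * C (k - i))
  refine squeeze_zero' (Eventually.of_forall fun ξ => by positivity) ?_ hlim
  have : ∀ᶠ ξ : ℝ in cocompact ℝ, 1 ≤ ‖ξ‖ := (tendsto_norm_cocompact_atTop (E := ℝ)).eventually_ge_atTop 1
  filter_upwards [this] with ξ hξ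
  exact hmain ξ hξ

lemma abs_pow_inv_deriv (m : ℕ) {t : ℝ} (ht : t ≠ 0) :
    HasDerivAt (fun t : ℝ => (((|t| ^ m)⁻¹ : ℝ) : ℂ)) (-(m : ℂ) * ((|t| ^ m)⁻¹ : ℝ) * (t : ℂ)⁻¹) t := by
  have hat : |t| ≠ 0 := abs_ne_zero.2 ht
  have h1 : HasDerivAt (fun t : ℝ => |t|) (|t| / t) t := by
    rcases lt_or_gt_of_ne ht with h | h
    · refine (hasDerivAt_abs_neg h).congr_deriv ?_
      rw [abs_of_neg h, neg_div, div_self ht]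
    · refine (hasDerivAt_abs_pos h).congr_deriv ?_
      rw [abs_of_pos h, div_self ht]
  have h2 := ((h1.fun_pow m).fun_inv (pow_ne_zero m hat)).ofReal_comp
  refine h2.congr_deriv ?_
  have ht' : (t : ℂ) ≠ 0 := by exact_mod_cast ht
  have hat' : ((|t| : ℝ) : ℂ) ≠ 0 := by exact_mod_cast hat
  cases m with
  | zero => simp
  | succ m =>
    simp only [Nat.add_sub_cancel]
    push_cast
    field_simp
    ring

section onedim
variable {X : Type*} [MeasurableSpace X] {μ : Measure X} {q : X → ℝ} {φ : X → ℂ}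

lemma deriv_bound (hq : Measurable q) (hint : ∀ k : ℕ, Integrable (fun x => (q x : ℂ) ^ k * φ x) μ)
    (m : ℕ) {G : ℝ → ℂ} (hG : ContDiff ℝ (⊤ : ℕ∞) G)
    (hF : ∀ t : ℝ, t ≠ 0 → chF μ q φ t = (((|t| ^ m)⁻¹ : ℝ) : ℂ) * G t⁻¹) (k : ℕ) :
    ∃ C : ℝ, ∀ t : ℝ, 1 ≤ |t| → ‖chF μ q (fun x => (q x : ℂ) ^ k * φ x) t‖ * |t| ^ (m + k) ≤ C := by
  have hex : ∀ k : ℕ, ∃ Gk : ℝ → ℂ, ContDiff ℝ (⊤ : ℕ∞) Gk ∧ ∀ t : ℝ, t ≠ 0 →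
      (-(2 * Real.pi * Complex.I)) ^ k * chF μ q (fun x => (q x : ℂ) ^ k * φ x) t =
        (((|t| ^ m)⁻¹ : ℝ) : ℂ) * ((t : ℂ)⁻¹ ^ k * Gk t⁻¹) := by
    intro k
    induction k with
    | zero => exact ⟨G, hG, fun t ht => by simpa using hF t ht⟩
    | succ k ih =>
      obtain ⟨Gk, hGk, h⟩ := ih
      refine ⟨fun s => -((m + k : ℕ) : ℂ) * Gk s - s * deriv Gk s, ?_, fun t ht => ?_⟩
      · exact (contDiff_const.mul hGk).sub (Complex.ofRealCLM.contDiff.mul (contDiff_infty_iff_deriv.1 hGk).2)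
      · have h1 := chF_tower hq hint k t
        have ht' : (t : ℂ) ≠ 0 := by exact_mod_cast ht
        have hi : HasDerivAt (fun t : ℝ => t⁻¹) (-(t^2)⁻¹) t := hasDerivAt_inv ht
        have hic : HasDerivAt (fun t : ℝ => (t : ℂ)⁻¹) (-((t:ℂ)^2)⁻¹) t := (hasDerivAt_inv ht').comp_ofReal
        have hGd : HasDerivAt (fun t : ℝ => Gk t⁻¹) ((-(t^2)⁻¹ : ℝ) • deriv Gk t⁻¹) t :=
          HasDerivAt.scomp t ((contDiff_infty_iff_deriv.1 hGk).1 t⁻¹).hasDerivAt hi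
        have h2 := (abs_pow_inv_deriv m ht).fun_mul ((hic.fun_pow k).fun_mul hGd)
        have h3 := h1.congr_of_eventuallyEq (f₁ := fun t : ℝ => (((|t| ^ m)⁻¹ : ℝ) : ℂ) * ((t : ℂ)⁻¹ ^ k * Gk t⁻¹)) (by
          filter_upwards [isOpen_ne.mem_nhds ht] with y hy
          exact (h y hy).symm)
        rw [h3.unique h2, Complex.real_smul]
        cases k with
        | zero => simp; field_simp; ring
        | succ k =>
          simp only [Nat.add_sub_cancel]
          push_cast
          simp only [inv_pow]
          field_simp
          ring
  obtain ⟨Gk, hGk, h⟩ := hex k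
  obtain ⟨M, hM⟩ := (isCompact_Icc (a := (-1:ℝ)) (b := 1)).exists_bound_of_continuousOn hGk.continuous.continuousOn
  refine ⟨((2 * Real.pi) ^ k)⁻¹ * M, fun t ht => ?_⟩
  have ht0 : t ≠ 0 := by rintro rfl; norm_num at ht
  have htp : 0 < |t| := abs_pos.2 ht0
  have h1 := congrArg norm (h t ht0)
  simp only [norm_mul, norm_pow, norm_neg, Complex.norm_I, mul_one, Complex.norm_real, norm_inv, Real.norm_eq_abs, abs_abs,
    abs_of_pos Real.pi_pos, Complex.norm_ofNat] at h1
  have h2 := hM t⁻¹ (abs_le.1 (by rw [abs_inv]; exact inv_le_one_of_one_le₀ ht))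
  have hp : 0 < (2 * Real.pi) ^ k := by positivity
  rw [inv_mul_eq_div, le_div_iff₀ hp]
  calc _ = ((2 * Real.pi) ^ k * ‖chF μ q (fun x => (q x : ℂ) ^ k * φ x) t‖) * |t| ^ (m + k) := by ring
    _ = ‖Gk t⁻¹‖ := by
      rw [h1, pow_add, inv_pow]; field_simp
    _ ≤ M := h2

lemma chF_sum (hq : Measurable q) {ι : Type*} (s : Finset ι) (c : ι → ℂ) (ψ : ι → X → ℂ) (h : ∀ i, Integrable (ψ i) μ) (t : ℝ) :
    chF μ q (fun x => ∑ i ∈ s, c i * ψ i x) t = ∑ i ∈ s, c i * chF μ q (ψ i) t := by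
  simp only [chF, Finset.mul_sum]
  rw [integral_finsetSum]
  · refine Finset.sum_congr rfl fun i _ => ?_
    rw [← integral_const_mul]
    congr 1; funext x; ring
  · intro i _
    refine ((chF_integrable hq (h i) t).const_mul (c i)).congr (ae_of_all _ fun x => ?_)
    ring

lemma RD.sum {ι : Type*} (s : Finset ι) (f : ι → ℝ → ℂ) (h : ∀ i, RD (f i)) : RD (fun t => ∑ i ∈ s, f i t) := by
  classical
  induction s using Finset.induction_on with
  | empty => intro N; exact ⟨0, fun t _ => by simp⟩
  | insert a s ha ih =>
    refine ((h a).add ih).mono fun t _ => ?_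
    rw [Finset.sum_insert ha]

lemma remainder (m : ℕ) (hm : 1 ≤ m) {G : ℝ → ℂ} (hG : ContDiff ℝ (⊤ : ℕ∞) G) {F : ℝ → ℂ}
    (hF : ∀ t : ℝ, t ≠ 0 → F t = (((|t| ^ m)⁻¹ : ℝ) : ℂ) * G t⁻¹) {e : ℝ → ℂ} {κ : ℂ} (hκ : κ ≠ 0)
    (he : ∀ j : ℕ, RD (fun t => (-(2 * Real.pi * Complex.I)) ^ j * chF volume (fun x : ℝ => x) (fun ξ : ℝ => (ξ : ℂ) ^ j * e ξ) t
      - (-1) ^ j * j.factorial * κ * (((t / |t|) ^ m : ℝ) : ℂ) / (t : ℂ) ^ (j + 1))) :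
    ∃ c : ℕ → ℂ, (∀ j, j < m - 1 → c j = 0) ∧ ∀ n : ℕ, ∃ C : ℝ, ∀ t : ℝ, 1 ≤ |t| →
      ‖F t - ∑ j ∈ Finset.range (m - 1 + n), c j * chF volume (fun x : ℝ => x) (fun ξ : ℝ => (ξ : ℂ) ^ j * e ξ) t‖
        * |t| ^ (m + n) ≤ C := by
  obtain ⟨a, ha⟩ := taylor_bound hG
  have hpi : (Real.pi : ℂ) ≠ 0 := by exact_mod_cast Real.pi_ne_zero
  have h2pi : (-(2 * Real.pi * Complex.I)) ≠ 0 := by simp [hpi]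
  set z : ℂ := -(2 * Real.pi * Complex.I) with hz
  set c : ℕ → ℂ := fun j => if j < m - 1 then 0 else a (j - (m-1)) * z ^ j / ((-1) ^ j * j.factorial * κ) with hc
  refine ⟨c, fun j hj => by simp [hc, hj], fun n => ?_⟩
  obtain ⟨C, hC⟩ := ha n
  set Ee : ℕ → ℝ → ℂ := fun j t => z ^ j * chF volume (fun x : ℝ => x) (fun ξ : ℝ => (ξ : ℂ) ^ j * e ξ) t
      - (-1) ^ j * j.factorial * κ * (((t / |t|) ^ m : ℝ) : ℂ) / (t : ℂ) ^ (j + 1) with hEe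
  have hRD : RD (fun t => ∑ i ∈ Finset.range n, (c (m-1+i) / z ^ (m-1+i)) * Ee (m-1+i) t) :=
    RD.sum _ _ fun i => (he (m-1+i)).const_mul _
  obtain ⟨C2, hC2⟩ := hRD (m + n)
  refine ⟨C + C2, fun t ht => ?_⟩
  have ht0 : t ≠ 0 := by rintro rfl; norm_num at ht
  have ht' : (t : ℂ) ≠ 0 := by exact_mod_cast ht0
  have htp : 0 < |t| := abs_pos.2 ht0
  have hat' : ((|t| : ℝ) : ℂ) ≠ 0 := by exact_mod_cast htp.ne'
  have key : F t - ∑ j ∈ Finset.range (m - 1 + n), c j * chF volume (fun x : ℝ => x) (fun ξ : ℝ => (ξ : ℂ) ^ j * e ξ) t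
      = (((|t| ^ m)⁻¹ : ℝ) : ℂ) * (G t⁻¹ - ∑ i ∈ Finset.range n, a i * ((t⁻¹ : ℝ) : ℂ) ^ i)
        - ∑ i ∈ Finset.range n, (c (m-1+i) / z ^ (m-1+i)) * Ee (m-1+i) t := by
    rw [Finset.sum_range_add, hF t ht0, mul_sub, Finset.mul_sum]
    have h0 : ∑ j ∈ Finset.range (m-1), c j * chF volume (fun x : ℝ => x) (fun ξ : ℝ => (ξ : ℂ) ^ j * e ξ) t = 0 := by
      refine Finset.sum_eq_zero fun j hj => ?_
      simp [hc, Finset.mem_range.1 hj]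
    rw [h0, zero_add, sub_sub, ← Finset.sum_add_distrib]
    congr 1
    refine Finset.sum_congr rfl fun i _ => ?_
    have hcv : c (m-1+i) = a i * z ^ (m-1+i) / ((-1) ^ (m-1+i) * (m-1+i).factorial * κ) := by
      simp [hc]
    have hfac : (((m-1+i).factorial : ℕ) : ℂ) ≠ 0 := by exact_mod_cast Nat.factorial_ne_zero _
    have hzp := pow_ne_zero (m-1+i) h2pi
    have h1p : ((-1 : ℂ)) ^ (m-1+i) ≠ 0 := pow_ne_zero _ (by norm_num)
    simp only [hEe, mul_sub]
    have e1 : c (m-1+i) / z ^ (m-1+i) * ((-1) ^ (m-1+i) * (m-1+i).factorial * κ * (((t / |t|) ^ m : ℝ) : ℂ) / (t : ℂ) ^ (m-1+i + 1))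
      = (((|t| ^ m)⁻¹ : ℝ) : ℂ) * (a i * ((t⁻¹ : ℝ) : ℂ) ^ i) := by
      rw [hcv, show m - 1 + i + 1 = m + i by omega, pow_add (t : ℂ), div_pow]
      push_cast
      simp only [inv_pow]
      field_simp
    rw [e1]
    field_simp
    ring
  rw [key]
  have hb1 := hC t⁻¹ (by rw [abs_inv]; exact inv_le_one_of_one_le₀ ht)
  have hb2 := hC2 t ht
  calc _ ≤ (‖(((|t| ^ m)⁻¹ : ℝ) : ℂ) * (G t⁻¹ - ∑ i ∈ Finset.range n, a i * ((t⁻¹ : ℝ) : ℂ) ^ i)‖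
        + ‖∑ i ∈ Finset.range n, (c (m-1+i) / z ^ (m-1+i)) * Ee (m-1+i) t‖) * |t| ^ (m + n) := by
        gcongr; exact norm_sub_le _ _
    _ ≤ ((|t| ^ m)⁻¹ * (C * |t⁻¹| ^ n)) * |t| ^ (m + n) + C2 := by
        rw [add_mul]
        refine add_le_add ?_ hb2
        rw [norm_mul, Complex.norm_real, Real.norm_of_nonneg (by positivity)]
        gcongr
    _ = _ := by
        rw [abs_inv, pow_add, inv_pow]; field_simp
end onedim

lemma e_contDiffAt {m : ℕ} {e A : ℝ → ℂ} {b : ℂ} (hA : ContDiff ℝ (⊤ : ℕ∞) A)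
    (he : ∀ ξ : ℝ, ξ ≠ 0 → e ξ = A ξ + b * wmod m ξ) (n : ℕ) {x : ℝ} (hx : x ≠ 0) : ContDiffAt ℝ n e x := by
  have h1 : ContDiffAt ℝ n (fun ξ => A ξ + b * wmod m ξ) x :=
    ((hA.of_le (by exact_mod_cast le_top)).contDiffAt).add (contDiffAt_const.mul (wmod_contDiffAt m n hx))
  refine h1.congr_of_eventuallyEq ?_
  filter_upwards [isOpen_ne.mem_nhds hx] with y hy
  exact he y hy

lemma pow_e_contDiff {m : ℕ} {e A : ℝ → ℂ} {b : ℂ} (hA : ContDiff ℝ (⊤ : ℕ∞) A)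
    (he : ∀ ξ : ℝ, ξ ≠ 0 → e ξ = A ξ + b * wmod m ξ) (n N : ℕ) (hN : n + 1 ≤ N) :
    ContDiff ℝ n (fun x : ℝ => (x:ℂ) ^ N * e x) := by
  have h0 : ContDiff ℝ n (fun x : ℝ => (x:ℂ) ^ (N - (n+1)) * ((x:ℂ) ^ (n+1) * A x + b * ((x:ℂ) ^ (n+1) * wmod m x))) := by
    refine (Complex.ofRealCLM.contDiff.pow _).mul (((Complex.ofRealCLM.contDiff.pow _).mul (hA.of_le (by exact_mod_cast le_top))).add
      (contDiff_const.mul (wmod_contDiff m n)))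
  convert h0 using 1
  funext x
  have hp : (x:ℂ) ^ N = (x:ℂ) ^ (N - (n+1)) * (x:ℂ)^(n+1) := by rw [← pow_add]; congr 1; omega
  by_cases hx : x = 0
  · subst hx
    rw [hp]; simp
  · rw [he x hx, hp]; ring

lemma cut_contDiff {m : ℕ} {e A χ : ℝ → ℂ} {b : ℂ} (hA : ContDiff ℝ (⊤ : ℕ∞) A)
    (he : ∀ ξ : ℝ, ξ ≠ 0 → e ξ = A ξ + b * wmod m ξ) (hχ : ContDiff ℝ (⊤ : ℕ∞) χ)
    (h1 : χ =ᶠ[nhds 0] fun _ => 1) (n : ℕ) :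
    ContDiff ℝ n (fun x : ℝ => (1 - χ x) * e x) := by
  rw [contDiff_iff_contDiffAt]
  intro x
  by_cases hx : x = 0
  · subst hx
    refine (contDiffAt_const (c := (0:ℂ))).congr_of_eventuallyEq ?_
    filter_upwards [h1] with y hy
    rw [hy]; simp
  · exact (contDiffAt_const.sub (hχ.of_le (by exact_mod_cast le_top)).contDiffAt).mul (e_contDiffAt hA he n hx)

lemma eq_of_eqOn_off {f g : ℝ → ℂ} (hf : Continuous f) (hg : Continuous g) (h : Set.EqOn f g ({0}ᶜ : Set ℝ)) : f = g :=
  Continuous.ext_on (dense_compl_singleton 0) hf hg h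

lemma onedim {X : Type*} [MeasurableSpace X] {μ : Measure X} [SFinite μ] {q : X → ℝ} {φ : X → ℂ}
    (hq : Measurable q) (hint : ∀ k : ℕ, Integrable (fun x => (q x : ℂ) ^ k * φ x) μ)
    (m : ℕ) (hm : 1 ≤ m) {G : ℝ → ℂ} (hG : ContDiff ℝ (⊤ : ℕ∞) G)
    (hF : ∀ t : ℝ, t ≠ 0 → chF μ q φ t = (((|t| ^ m)⁻¹ : ℝ) : ℂ) * G t⁻¹) :
    ∃ f : ℝ → ℂ, (∀ n : ℕ, ContDiffOn ℝ n f ({0}ᶜ : Set ℝ)) ∧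
      (∀ g : ℝ → ℂ, Continuous g → HasCompactSupport g → ∫ x, g (q x) * φ x ∂μ = ∫ ξ, g ξ * f ξ) ∧
      (∀ N k : ℕ, Tendsto (fun ξ : ℝ => |ξ| ^ N * ‖iteratedDeriv k f ξ‖) (cocompact ℝ) (nhds 0)) ∧
      ∃ C₀ C₁ : ℝ → ℂ, (∀ n : ℕ, ContDiff ℝ n C₀) ∧ (∀ n : ℕ, ContDiff ℝ n C₁) ∧
        ∀ ξ : ℝ, ξ ≠ 0 → f ξ = C₀ ξ + C₁ ξ * ((ξ : ℂ) ^ (m-1) * wmod m ξ) := by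
  obtain ⟨e, A, b, κ, hκ, hei, hA, heA, heRD⟩ := model_exists m
  obtain ⟨c, hc0, hcR⟩ := remainder m hm hG hF hκ heRD
  obtain ⟨χ, D, hχ, hχ1, hD, hDrec⟩ := borel_aux c
  have hφ : Integrable φ μ := by simpa using hint 0
  set S : ℕ → ℝ → ℂ := fun n ξ => ∑ j ∈ Finset.range (m - 1 + n), c j * ((ξ : ℂ) ^ j * e ξ) with hS
  have hSi : ∀ n, Integrable (S n) := fun n => integrable_finsetSum _ fun j _ => (hei j).const_mul (c j)
  set R : ℕ → ℝ → ℂ := fun n t => chF μ q φ t - chF volume (fun x : ℝ => x) (S n) t with hR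
  have hRc : ∀ n, Continuous (R n) := fun n => (chF_continuous hq hφ).sub (chF_continuous measurable_id (hSi n))
  have hRd : ∀ n, ∃ C : ℝ, ∀ t : ℝ, 1 ≤ |t| → ‖R n t‖ * |t| ^ (m + n) ≤ C := by
    intro n
    obtain ⟨C, hC⟩ := hcR n
    refine ⟨C, fun t ht => ?_⟩
    have := hC t ht
    rwa [← chF_sum (q := fun x : ℝ => x) measurable_id _ _ _ hei] at this
  have hRi : ∀ n, ∀ k ≤ n, Integrable (fun t : ℝ => (t : ℂ) ^ k * R (n+1) t) := by
    intro n k hk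
    obtain ⟨C, hC⟩ := hRd (n+1)
    refine integrable_pow_of_decay (hRc _) (n := m - 1 + n) (C := C) ?_ k (by omega)
    rw [show m - 1 + n + 2 = m + (n + 1) by omega]
    exact hC
  set r : ℕ → ℝ → ℂ := fun n => ift (R (n+1)) with hr
  have hrC : ∀ n : ℕ, ContDiff ℝ n (r n) := fun n => ift_contDiff n (hRi n)
  set f : ℕ → ℝ → ℂ := fun n ξ => S (n+1) ξ + r n ξ with hf
  have hpair : ∀ n, ∀ g : ℝ → ℂ, ContDiff ℝ (⊤ : ℕ∞) g → HasCompactSupport g →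
      ∫ x, g (q x) * φ x ∂μ = ∫ ξ, g ξ * f n ξ := by
    intro n g hg hgc
    have h0 : Integrable (R (n+1)) := by simpa using hRi n 0 (by omega)
    exact pairing_split hq hφ (hSi (n+1)) h0 (fun t => by simp [hR]) hg hgc
  have hSc : ∀ n, ∀ k : ℕ, ∀ x : ℝ, x ≠ 0 → ContDiffAt ℝ k (S n) x := by
    intro n k x hx
    refine ContDiffAt.sum fun j _ => contDiffAt_const.mul (ContDiffAt.mul ?_ (e_contDiffAt hA heA k hx))
    exact (Complex.ofRealCLM.contDiff.pow _).contDiffAt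
  have hfc : ∀ n, ContinuousOn (f n) ({0}ᶜ : Set ℝ) := fun n x hx =>
    ((hSc (n+1) 0 x hx).continuousAt.add (hrC n).continuous.continuousAt).continuousWithinAt
  have hgC : ∀ g : ℝ → ℝ, ContDiff ℝ (⊤ : ℕ∞) g → HasCompactSupport g →
      ContDiff ℝ (⊤ : ℕ∞) (fun x => (g x : ℂ)) ∧ HasCompactSupport (fun x => (g x : ℂ)) := by
    intro g hg hgc
    exact ⟨Complex.ofRealCLM.contDiff.comp hg, hgc.comp_left (g := fun x : ℝ => (x : ℂ)) (by simp)⟩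
  have hff : ∀ n, Set.EqOn (f n) (f 0) ({0}ᶜ : Set ℝ) := fun n => uniq_off (hfc n) (hfc 0) fun g hg hgc _ => by
    obtain ⟨h1, h2⟩ := hgC g hg hgc
    rw [← hpair n _ h1 h2, ← hpair 0 _ h1 h2]
  have hDsum : ∀ N : ℕ, ∀ x : ℝ, D 0 x = ∑ j ∈ Finset.range N, c j * ((x : ℂ) ^ j * χ j x) + (x : ℂ) ^ N * D N x := by
    intro N x
    induction N with
    | zero => simp
    | succ N ih =>
      rw [ih, hDrec N x, Finset.sum_range_succ]; ring
  set B : ℕ → ℝ → ℂ := fun n x => r n x + ∑ j ∈ Finset.range (m - 1 + (n+1)), c j * ((x : ℂ) ^ j * ((1 - χ j x) * e x))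
    - D (m - 1 + (n+1)) x * ((x : ℂ) ^ (m - 1 + (n+1)) * e x) with hB
  have hBC : ∀ n : ℕ, ContDiff ℝ n (B n) := by
    intro n
    refine ((hrC n).add (ContDiff.sum fun j _ => contDiff_const.mul ((Complex.ofRealCLM.contDiff.pow _).mul
      (cut_contDiff hA heA (hχ j) (hχ1 j) n)))).sub (((hD _).of_le (by exact_mod_cast le_top)).mul (pow_e_contDiff hA heA n _ (by omega)))
  have hBf : ∀ n x, B n x = f n x - D 0 x * e x := by
    intro n x
    have h1 : ∑ j ∈ Finset.range (m - 1 + (n+1)), c j * ((x : ℂ) ^ j * ((1 - χ j x) * e x)) =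
        S (n+1) x - (∑ j ∈ Finset.range (m - 1 + (n+1)), c j * ((x : ℂ) ^ j * χ j x)) * e x := by
      simp only [hS]
      rw [Finset.sum_mul, ← Finset.sum_sub_distrib]
      exact Finset.sum_congr rfl fun j _ => by ring
    simp only [hB, hf]
    rw [h1, hDsum (m - 1 + (n+1)) x]; ring
  have hBB : ∀ n, B 0 = B n := fun n => (eq_of_eqOn_off (hBC n).continuous (hBC 0).continuous fun x hx => by
    rw [hBf, hBf, hff n hx]).symm
  have hH : ∀ n : ℕ, ContDiff ℝ n (B 0) := fun n => by rw [hBB n]; exact hBC n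
  have hfB : ∀ x, f 0 x = B 0 x + D 0 x * e x := fun x => by rw [hBf]; ring
  have hsm : ∀ n : ℕ, ContDiffOn ℝ n (f 0) ({0}ᶜ : Set ℝ) := by
    intro n x hx
    have : f 0 = fun x => B 0 x + D 0 x * e x := funext hfB
    rw [this]
    exact ((hH n).contDiffAt.add (((hD 0).of_le (by exact_mod_cast le_top)).contDiffAt.mul
      (e_contDiffAt hA heA n hx))).contDiffWithinAt
  refine ⟨f 0, hsm, ?_, ?_, fun x => B 0 x + D 0 x * A x, fun x => b * D (m-1) x, ?_, ?_, ?_⟩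
  · intro g hg hgc
    refine pairing_continuous hq hφ ?_ (hpair 0) hg hgc
    exact (hSi 1).locallyIntegrable.add (hrC 0).continuous.locallyIntegrable
  · intro N k
    have hK : ∀ N, k ≤ N → Tendsto (fun ξ : ℝ => |ξ| ^ N * ‖iteratedDeriv k (f 0) ξ‖) (cocompact ℝ) (nhds 0) := by
      intro N hN
      set ψ : X → ℂ := fun x => (q x : ℂ) ^ (N+1) * φ x with hψ
      obtain ⟨C, hC⟩ := deriv_bound hq hint m hG hF (N+1)
      have hψc : Continuous (chF μ q ψ) := chF_continuous hq (hint (N+1))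
      have hi : ∀ i ≤ k, Integrable (fun t : ℝ => (t : ℂ) ^ i * chF μ q ψ t) := fun i hik =>
        integrable_pow_of_decay hψc (n := m - 1 + N) (C := C) (by
          rw [show m - 1 + N + 2 = m + (N + 1) by omega]; exact hC) i (by omega)
      have huC : ContDiff ℝ k (ift (chF μ q ψ)) := ift_contDiff k hi
      refine decay_of_quot N k huC (fun i hik => ift_bounded i fun j hj => hi j (hj.trans hik)) ?_
      have heq : Set.EqOn (fun ξ : ℝ => (ξ:ℂ) ^ (N+1) * f 0 ξ) (ift (chF μ q ψ)) ({0}ᶜ : Set ℝ) := by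
        refine uniq_off ?_ huC.continuous.continuousOn ?_
        · exact ContinuousOn.mul (by fun_prop) (hfc 0)
        · intro g hg hgc _
          obtain ⟨h1, h2⟩ := hgC g hg hgc
          have hI : Integrable (chF μ q ψ) := by simpa using hi 0 (by omega)
          have e1 := pairing_split hq (hint (N+1)) (e := fun _ => 0) (integrable_zero _ _ _) hI (fun t => by simp [chF, hψ]) h1 h2
          have h1' : ContDiff ℝ (⊤ : ℕ∞) (fun x : ℝ => (g x : ℂ) * (x:ℂ) ^ (N+1)) :=
            h1.mul (Complex.ofRealCLM.contDiff.pow _)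
          have e2 := hpair 0 _ h1' h2.mul_right
          simp only [zero_add] at e1
          rw [← e1]
          calc _ = ∫ ξ : ℝ, (g ξ : ℂ) * (ξ : ℂ) ^ (N+1) * f 0 ξ := by congr 1; funext ξ; ring
            _ = _ := by rw [← e2]; congr 1; funext x; ring
      exact fun ξ hξ => heq hξ
    refine squeeze_zero_norm' ?_ (hK (N + k) (by omega))
    have hev : ∀ᶠ ξ : ℝ in cocompact ℝ, 1 ≤ |ξ| := by
      have := tendsto_norm_cocompact_atTop (E := ℝ) |>.eventually_ge_atTop 1
      simpa using this
    filter_upwards [hev] with ξ hξ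
    rw [norm_mul, norm_pow, Real.norm_eq_abs, abs_abs, norm_norm]
    gcongr
    omega
  · intro n
    exact (hH n).add (((hD 0).of_le (by exact_mod_cast le_top)).mul (hA.of_le (by exact_mod_cast le_top)))
  · intro n
    exact contDiff_const.mul ((hD _).of_le (by exact_mod_cast le_top))
  · intro x hx
    have h0 : D 0 x = (x:ℂ) ^ (m-1) * D (m-1) x := by
      rw [hDsum (m-1) x, Finset.sum_eq_zero, zero_add]
      intro j hj
      rw [hc0 j (Finset.mem_range.1 hj), zero_mul]
    simp only [hfB, heA x hx, h0]; ring

lemma schwartz_int {V : Type*} [NormedAddCommGroup V] [NormedSpace ℝ V] [MeasurableSpace V] [BorelSpace V]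
    [SecondCountableTopology V] (μ : Measure V) [μ.HasTemperateGrowth] (Φ : SchwartzMap V ℂ) {q : V → ℝ}
    (hq : Continuous q) {C : ℝ} (hC : ∀ x, |q x| ≤ C * ‖x‖ ^ 2) (k : ℕ) :
    Integrable (fun x => (q x : ℂ) ^ k * Φ x) μ := by
  refine Integrable.mono' ((SchwartzMap.integrable_pow_mul μ Φ (2 * k)).const_mul (C ^ k)) ?_ (ae_of_all _ fun x => ?_)
  · have : Continuous (fun x => (q x : ℂ) ^ k * Φ x) := by
      have := Φ.continuous
      fun_prop
    exact this.aestronglyMeasurable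
  · rw [norm_mul, norm_pow, Complex.norm_real, Real.norm_eq_abs, ← mul_assoc, pow_mul, ← mul_pow]
    gcongr
    exact hC x

section four
variable {E : Type*} [NormedAddCommGroup E] [InnerProductSpace ℝ E] [FiniteDimensional ℝ E] [MeasurableSpace E] [BorelSpace E]

lemma toLp_me : MeasurableEmbedding (WithLp.toLp 2 : E × E → WithLp 2 (E × E)) :=
  (MeasurableEquiv.toLp 2 (E × E)).measurableEmbedding

lemma norm_fst_le_toLp (z : E × E) : ‖z.1‖ ≤ ‖WithLp.toLp 2 z‖ := by
  have := WithLp.prod_norm_sq_eq_of_L2 (WithLp.toLp 2 z)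
  have h1 : ‖z.1‖ ^ 2 ≤ ‖WithLp.toLp 2 z‖ ^ 2 := by
    rw [this]; have := sq_nonneg ‖z.2‖; simpa using this
  exact le_of_sq_le_sq h1 (norm_nonneg _)

lemma norm_snd_le_toLp (z : E × E) : ‖z.2‖ ≤ ‖WithLp.toLp 2 z‖ := by
  have := WithLp.prod_norm_sq_eq_of_L2 (WithLp.toLp 2 z)
  have h1 : ‖z.2‖ ^ 2 ≤ ‖WithLp.toLp 2 z‖ ^ 2 := by
    rw [this]; have := sq_nonneg ‖z.1‖; simpa using this
  exact le_of_sq_le_sq h1 (norm_nonneg _)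

lemma inner_int (Φ : SchwartzMap (WithLp 2 (E × E)) ℂ) (k : ℕ) :
    Integrable (fun z : E × E => ((inner ℝ z.1 z.2 : ℝ) : ℂ) ^ k * Φ (WithLp.toLp 2 z)) := by
  have h := schwartz_int volume Φ (q := fun w => inner ℝ w.ofLp.1 w.ofLp.2) (C := 1) (by fun_prop) (fun w => by
    refine (abs_real_inner_le_norm _ _).trans ?_
    rw [one_mul, sq]
    exact mul_le_mul (norm_fst_le_toLp w.ofLp) (norm_snd_le_toLp w.ofLp) (norm_nonneg _) (norm_nonneg _)) k
  exact ((WithLp.volume_preserving_toLp E E).integrable_comp_emb toLp_me).2 h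

lemma slice_bound (Φ : SchwartzMap (WithLp 2 (E × E)) ℂ) : ∃ b : E → ℝ, Integrable b ∧
    ∀ x y, ‖Φ (WithLp.toLp 2 (x, y))‖ ≤ b x ∧ ‖Φ (WithLp.toLp 2 (x, y))‖ ≤ b y := by
  set N := Module.finrank ℝ E + 1 with hN
  set C := 2 ^ N * ((Finset.Iic (N, 0)).sup fun m => SchwartzMap.seminorm ℂ m.1 m.2) Φ with hC
  have hb : ∀ w, (1 + ‖w‖) ^ N * ‖Φ w‖ ≤ C := fun w => by
    have := SchwartzMap.one_add_le_sup_seminorm_apply (𝕜 := ℂ) (m := (N, 0)) (k := N) (n := 0) le_rfl le_rfl Φ w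
    simpa using this
  have hCn : 0 ≤ C := le_trans (by positivity) (hb 0)
  refine ⟨fun x => C * (1 + ‖x‖) ^ (-(N : ℝ)), (integrable_one_add_norm (by rw [hN]; push_cast; linarith)).const_mul C, ?_⟩
  have key : ∀ (x : E) (w : WithLp 2 (E × E)), ‖x‖ ≤ ‖w‖ → ‖Φ w‖ ≤ C * (1 + ‖x‖) ^ (-(N : ℝ)) := by
    intro x w hxw
    have hp : 0 < (1 + ‖x‖) ^ N := by positivity
    rw [Real.rpow_neg (by positivity), Real.rpow_natCast, ← div_eq_mul_inv, le_div_iff₀ hp, mul_comm]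
    refine le_trans ?_ (hb w)
    gcongr
  exact fun x y => ⟨key x _ (norm_fst_le_toLp (x, y)), key y _ (norm_snd_le_toLp (x, y))⟩

/-- partial Fourier transform in the second variable -/
def pft (Φ : SchwartzMap (WithLp 2 (E × E)) ℂ) (x η : E) : ℂ :=
  ∫ y : E, Complex.exp ((-2 * Real.pi * inner ℝ y η : ℝ) * Complex.I) * Φ (WithLp.toLp 2 (x, y))

lemma toLp_cont : Continuous (WithLp.toLp 2 : E × E → WithLp 2 (E × E)) := WithLp.prod_continuous_toLp 2 E E

lemma norm_exp_aux2 (r : ℝ) (z : ℂ) : ‖Complex.exp ((r : ℂ) * Complex.I) * z‖ = ‖z‖ := by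
  rw [norm_mul, Complex.norm_exp_ofReal_mul_I, one_mul]

lemma pft_cont (Φ : SchwartzMap (WithLp 2 (E × E)) ℂ) (η : E) : Continuous (fun x => pft Φ x η) := by
  obtain ⟨b, hb, hb2⟩ := slice_bound Φ
  have h1 : Continuous (fun z : E × E => Φ (WithLp.toLp 2 z)) := Φ.continuous.comp toLp_cont
  refine continuous_of_dominated (bound := b) ?_ ?_ hb ?_
  · intro x
    have : Continuous (fun y : E => Complex.exp ((-2 * Real.pi * inner ℝ y η : ℝ) * Complex.I) * Φ (WithLp.toLp 2 (x, y))) :=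
      (by fun_prop : Continuous (fun y : E => Complex.exp ((-2 * Real.pi * inner ℝ y η : ℝ) * Complex.I))).mul
        (h1.comp (Continuous.prodMk_right x))
    exact this.aestronglyMeasurable
  · exact fun x => ae_of_all _ fun y => by rw [norm_exp_aux2]; exact (hb2 x y).2
  · exact ae_of_all _ fun y => continuous_const.mul (h1.comp (Continuous.prodMk_left y))

lemma prod_exp_int (Φ : SchwartzMap (WithLp 2 (E × E)) ℂ) {r : E × E → ℝ} (hr : Continuous r) :
    Integrable (fun z : E × E => Complex.exp ((r z : ℂ) * Complex.I) * Φ (WithLp.toLp 2 z)) := by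
  have h0 : Integrable (fun z : E × E => Φ (WithLp.toLp 2 z)) := by simpa using inner_int Φ 0
  refine h0.bdd_mul (c := 1) ?_ ?_
  · exact Continuous.aestronglyMeasurable (by fun_prop)
  · exact ae_of_all _ fun x => (Complex.norm_exp_ofReal_mul_I _).le

lemma pft_int (Φ : SchwartzMap (WithLp 2 (E × E)) ℂ) (η : E) : Integrable (fun x => pft Φ x η) :=
  (prod_exp_int Φ (r := fun z => -2 * Real.pi * inner ℝ z.2 η) (by fun_prop)).integral_prod_left

lemma pft_fourier (Φ : SchwartzMap (WithLp 2 (E × E)) ℂ) (η ξ : E) :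
    FourierTransform.fourier (fun x => pft Φ x η) ξ =
      (FourierTransform.fourier Φ : SchwartzMap (WithLp 2 (E × E)) ℂ) (WithLp.toLp 2 (ξ, η)) := by
  have h1 := prod_exp_int Φ (r := fun z => -2 * Real.pi * inner ℝ z.1 ξ + -2 * Real.pi * inner ℝ z.2 η) (by fun_prop)
  rw [SchwartzMap.fourier_coe, Real.fourier_eq', Real.fourier_eq',
    ← (WithLp.volume_preserving_toLp E E).integral_comp toLp_me]
  simp only [WithLp.prod_inner_apply, smul_eq_mul, mul_add]
  rw [Measure.volume_eq_prod, integral_prod _ h1]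
  congr 1; funext x
  rw [pft, ← integral_const_mul]
  congr 1; funext y
  rw [← mul_assoc, ← Complex.exp_add]
  congr 2
  push_cast; ring

lemma pft_inv (Φ : SchwartzMap (WithLp 2 (E × E)) ℂ) (x η : E) :
    pft Φ x η = ∫ ξ : E, Complex.exp ((2 * Real.pi * inner ℝ ξ x : ℝ) * Complex.I) *
      (FourierTransform.fourier Φ : SchwartzMap (WithLp 2 (E × E)) ℂ) (WithLp.toLp 2 (ξ, η)) := by
  set Θ := (FourierTransform.fourier Φ : SchwartzMap (WithLp 2 (E × E)) ℂ) with hΘ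
  have hF : FourierTransform.fourier (fun x => pft Φ x η) = fun ξ => Θ (WithLp.toLp 2 (ξ, η)) :=
    funext fun ξ => pft_fourier Φ η ξ
  have hi : Integrable (fun ξ => Θ (WithLp.toLp 2 (ξ, η))) := by
    obtain ⟨b, hb, hb2⟩ := slice_bound Θ
    refine hb.mono' ?_ (ae_of_all _ fun x => (hb2 x η).1)
    exact ((Θ.continuous.comp toLp_cont).comp (Continuous.prodMk_left η)).aestronglyMeasurable
  have h := (pft_cont Φ η).fourierInv_fourier_eq (pft_int Φ η) (by rw [hF]; exact hi)
  have h2 := congrFun h x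
  rw [hF, Real.fourierInv_eq'] at h2
  rw [← h2]
  simp only [smul_eq_mul]

theorem fourier_main (Φ : SchwartzMap (WithLp 2 (E × E)) ℂ) : ∃ G : ℝ → ℂ, ContDiff ℝ (⊤ : ℕ∞) G ∧ ∀ t : ℝ, t ≠ 0 →
    chF volume (fun z : E × E => inner ℝ z.1 z.2) (fun z => Φ (WithLp.toLp 2 z)) t =
      (((|t| ^ (Module.finrank ℝ E))⁻¹ : ℝ) : ℂ) * G t⁻¹ := by
  set Θ := (FourierTransform.fourier Φ : SchwartzMap (WithLp 2 (E × E)) ℂ) with hΘ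
  have hqm : Measurable (fun z : E × E => (inner ℝ z.1 z.2 : ℝ)) := (by fun_prop : Continuous _).measurable
  refine ⟨fun s => chF volume (fun z : E × E => inner ℝ z.1 z.2) (fun z => Θ (WithLp.toLp 2 z)) (-s), ?_, ?_⟩
  · have h : ContDiff ℝ (⊤ : ℕ∞) (chF volume (fun z : E × E => inner ℝ z.1 z.2) (fun z => Θ (WithLp.toLp 2 z))) := by
      rw [contDiff_infty]
      exact fun n => chF_contDiff hqm n fun k _ => inner_int Θ k
    exact h.comp contDiff_neg
  · intro t ht
    have hG : chF volume (fun z : E × E => inner ℝ z.1 z.2) (fun z => Θ (WithLp.toLp 2 z)) (-t⁻¹) =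
        ∫ η : E, pft Φ (t⁻¹ • η) η := by
      rw [chF, Measure.volume_eq_prod, integral_prod_symm]
      · congr 1; funext η
        rw [pft_inv]
        congr 1; funext ξ
        congr 2
        rw [inner_smul_right]; push_cast; ring
      · exact chF_integrable hqm (by simpa using inner_int Θ 0 : Integrable (fun z : E × E => Θ (WithLp.toLp 2 z)) volume) _
    have hL : chF volume (fun z : E × E => inner ℝ z.1 z.2) (fun z => Φ (WithLp.toLp 2 z)) t =
        ∫ x : E, pft Φ (t⁻¹ • (t • x)) (t • x) := by
      rw [chF, Measure.volume_eq_prod, integral_prod]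
      · congr 1; funext x
        rw [inv_smul_smul₀ ht, pft]
        congr 1; funext y
        congr 2
        rw [inner_smul_right, real_inner_comm]; push_cast; ring
      · exact chF_integrable hqm (by simpa using inner_int Φ 0 : Integrable (fun z : E × E => Φ (WithLp.toLp 2 z)) volume) _
    beta_reduce
    rw [hL, hG, Measure.integral_comp_smul volume (fun η => pft Φ (t⁻¹ • η) η) t, Complex.real_smul, abs_inv, abs_pow]
end four

/-- splitting the coordinates into even and odd ones -/
def splitIdx (m d : ℕ) (h : d = 2 * m) : Fin m ⊕ Fin m ≃ Fin d :=
  Equiv.ofBijective (Sum.elim (fun i => ⟨2 * i, by omega⟩) (fun i => ⟨2 * i + 1, by omega⟩)) (by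
    rw [Fintype.bijective_iff_injective_and_card]
    refine ⟨?_, by simp; omega⟩
    rintro (⟨i, hi⟩ | ⟨i, hi⟩) (⟨j, hj⟩ | ⟨j, hj⟩) hij <;> simp [Fin.ext_iff] at hij ⊢ <;> omega)

/-- the coordinate map -/
def splitMap (m d : ℕ) (h : d = 2 * m) (z : EuclideanSpace ℝ (Fin m) × EuclideanSpace ℝ (Fin m)) (k : Fin d) : ℝ :=
  Sum.elim (fun i => z.1 i) (fun i => z.2 i) ((splitIdx m d h).symm k)

lemma splitMap_mp (m d : ℕ) (h : d = 2 * m) : MeasurePreserving (splitMap m d h) := by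
  have h1 := volume_measurePreserving_piCongrLeft (fun _ : Fin d => ℝ) (splitIdx m d h)
  have h2 := volume_measurePreserving_sumPiEquivProdPi_symm (fun _ : Fin m ⊕ Fin m => ℝ)
  have h3 := (PiLp.volume_preserving_ofLp (Fin m)).prod (PiLp.volume_preserving_ofLp (Fin m))
  have h4 := h1.comp (h2.comp h3)
  have he : splitMap m d h = (MeasurableEquiv.piCongrLeft (fun _ : Fin d => ℝ) (splitIdx m d h)) ∘
      (MeasurableEquiv.sumPiEquivProdPi fun _ : Fin m ⊕ Fin m => ℝ).symm ∘ Prod.map WithLp.ofLp WithLp.ofLp := by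
    funext z k
    obtain ⟨s, rfl⟩ := (splitIdx m d h).surjective k
    simp only [Function.comp]
    erw [Equiv.piCongrLeft_apply_apply]
    simp only [splitMap, Equiv.symm_apply_apply]
    rcases s with i | i <;> rfl
  rw [he]
  exact h4

/-- inverse of the coordinate map -/
def splitInv (m d : ℕ) (h : d = 2 * m) (x : Fin d → ℝ) : EuclideanSpace ℝ (Fin m) × EuclideanSpace ℝ (Fin m) :=
  (WithLp.toLp 2 fun i => x (splitIdx m d h (Sum.inl i)), WithLp.toLp 2 fun i => x (splitIdx m d h (Sum.inr i)))

lemma splitMap_add (m d : ℕ) (h : d = 2 * m) (a b : EuclideanSpace ℝ (Fin m) × EuclideanSpace ℝ (Fin m)) :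
    splitMap m d h (a + b) = splitMap m d h a + splitMap m d h b := by
  funext k
  simp only [splitMap, Pi.add_apply]
  rcases (splitIdx m d h).symm k with i | i <;> simp

lemma splitMap_smul (m d : ℕ) (h : d = 2 * m) (r : ℝ) (b : EuclideanSpace ℝ (Fin m) × EuclideanSpace ℝ (Fin m)) :
    splitMap m d h (r • b) = r • splitMap m d h b := by
  funext k
  simp only [splitMap, Pi.smul_apply]
  rcases (splitIdx m d h).symm k with i | i <;> simp

lemma splitInv_left (m d : ℕ) (h : d = 2 * m) (z : EuclideanSpace ℝ (Fin m) × EuclideanSpace ℝ (Fin m)) :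
    splitInv m d h (splitMap m d h z) = z := by
  ext i <;> simp [splitMap, splitInv]

lemma splitInv_right (m d : ℕ) (h : d = 2 * m) (x : Fin d → ℝ) :
    splitMap m d h (splitInv m d h x) = x := by
  funext k
  obtain ⟨s, rfl⟩ := (splitIdx m d h).surjective k
  rcases s with i | i <;> simp [splitMap, splitInv]

/-- linear version -/
def splitLE (m d : ℕ) (h : d = 2 * m) :
    WithLp 2 (EuclideanSpace ℝ (Fin m) × EuclideanSpace ℝ (Fin m)) ≃ₗ[ℝ] (Fin d → ℝ) where
  toFun := fun w => splitMap m d h w.ofLp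
  invFun := fun x => WithLp.toLp 2 (splitInv m d h x)
  map_add' := fun a b => splitMap_add m d h a.ofLp b.ofLp
  map_smul' := fun r b => splitMap_smul m d h r b.ofLp
  left_inv := fun w => congrArg (WithLp.toLp 2) (splitInv_left m d h w.ofLp)
  right_inv := fun x => splitInv_right m d h x

lemma splitMap_cont (m d : ℕ) (h : d = 2 * m) : Continuous (splitMap m d h) := by
  refine continuous_pi fun k => ?_
  simp only [splitMap]
  rcases (splitIdx m d h).symm k with i | i
  · simp only [Sum.elim_inl]; fun_prop
  · simp only [Sum.elim_inr]; fun_prop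

lemma splitInv_cont (m d : ℕ) (h : d = 2 * m) : Continuous (splitInv m d h) := by
  unfold splitInv
  refine Continuous.prodMk ?_ ?_
  · exact (PiLp.continuous_toLp 2 _).comp (continuous_pi fun i => continuous_apply _)
  · exact (PiLp.continuous_toLp 2 _).comp (continuous_pi fun i => continuous_apply _)

/-- continuous linear version -/
def splitLin (m d : ℕ) (h : d = 2 * m) :
    WithLp 2 (EuclideanSpace ℝ (Fin m) × EuclideanSpace ℝ (Fin m)) ≃L[ℝ] (Fin d → ℝ) :=
  { splitLE m d h with
    continuous_toFun := (splitMap_cont m d h).comp (WithLp.prod_continuous_ofLp 2 _ _)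
    continuous_invFun := toLp_cont.comp (splitInv_cont m d h) }

lemma splitQR_splitMap (m d : ℕ) (h : d = 2 * m) (z : EuclideanSpace ℝ (Fin m) × EuclideanSpace ℝ (Fin m)) :
    splitQR d (splitMap m d h z) = inner ℝ z.1 z.2 := by
  have hd : Even d := ⟨m, by omega⟩
  rw [splitQR, if_pos hd, show d / 2 = m by omega, Finset.sum_range, PiLp.inner_apply]
  refine Finset.sum_congr rfl fun i _ => ?_
  have e1 : padR (splitMap m d h z) (2 * i) = z.1 i := by
    rw [padR, dif_pos (by omega)]
    have : (⟨2 * i, by omega⟩ : Fin d) = splitIdx m d h (Sum.inl i) := rfl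
    rw [this]; simp [splitMap]
  have e2 : padR (splitMap m d h z) (2 * i + 1) = z.2 i := by
    rw [padR, dif_pos (by omega)]
    have : (⟨2 * i + 1, by omega⟩ : Fin d) = splitIdx m d h (Sum.inr i) := rfl
    rw [this]; simp [splitMap]
  rw [e1, e2]
  simp [mul_comm]

lemma splitMap_me (m d : ℕ) (h : d = 2 * m) : MeasurableEmbedding (splitMap m d h) := by
  have h1 : MeasurableEmbedding (splitLin m d h) := (splitLin m d h).toHomeomorph.measurableEmbedding
  exact h1.comp toLp_me

theorem germ_pushforward_real_even (d : ℕ) (hd : 2 ≤ d) (hde : Even d)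
    (Φ : SchwartzMap (Fin d → ℝ) ℂ) :
    ∃ f : ℝ → ℂ,
      (∀ n : ℕ, ContDiffOn ℝ n f ({0}ᶜ : Set ℝ)) ∧
      (∀ g : ℝ → ℂ, Continuous g → HasCompactSupport g → (0 : ℝ) ∉ tsupport g →
        ∫ x : Fin d → ℝ, g (splitQR d x) * Φ x = ∫ ξ : ℝ, g ξ * f ξ) ∧
      (∀ f' : ℝ → ℂ, (∀ n : ℕ, ContDiffOn ℝ n f' ({0}ᶜ : Set ℝ)) →
        (∀ g : ℝ → ℂ, Continuous g → HasCompactSupport g → (0 : ℝ) ∉ tsupport g →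
          ∫ x : Fin d → ℝ, g (splitQR d x) * Φ x = ∫ ξ : ℝ, g ξ * f' ξ) →
        Set.EqOn f' f ({0}ᶜ : Set ℝ)) ∧
      (∀ N k : ℕ, Tendsto (fun ξ : ℝ => |ξ| ^ N * ‖iteratedDeriv k f ξ‖)
        (cocompact ℝ) (nhds 0)) ∧
      (∃ C₀ C₁ : ℝ → ℂ,
        (∀ n : ℕ, ContDiff ℝ n C₀) ∧ (∀ n : ℕ, ContDiff ℝ n C₁) ∧
        ∀ ξ : ℝ, ξ ≠ 0 →
          f ξ = C₀ ξ + C₁ ξ * ((|ξ| ^ (d / 2 - 1) : ℝ) : ℂ) *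
            (if d % 4 = 2 then ((Real.log |ξ| : ℝ) : ℂ) else 1)) := by
  obtain ⟨m, hm⟩ : ∃ m, d = 2 * m := ⟨d / 2, by obtain ⟨r, hr⟩ := hde; omega⟩
  set Ψ : SchwartzMap (WithLp 2 (EuclideanSpace ℝ (Fin m) × EuclideanSpace ℝ (Fin m))) ℂ :=
    SchwartzMap.compCLMOfContinuousLinearEquiv ℂ (splitLin m d hm) Φ with hΨ
  have hΨe : ∀ z, Ψ (WithLp.toLp 2 z) = Φ (splitMap m d hm z) := fun z => rfl
  obtain ⟨G, hG, hGF⟩ := fourier_main Ψ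
  rw [finrank_euclideanSpace_fin] at hGF
  have hqm : Measurable (fun z : EuclideanSpace ℝ (Fin m) × EuclideanSpace ℝ (Fin m) => (inner ℝ z.1 z.2 : ℝ)) :=
    (by fun_prop : Continuous _).measurable
  obtain ⟨f, hf1, hf2, hf3, C₀, C₁, hC0, hC1, hC⟩ := onedim hqm (inner_int Ψ) m (by omega) hG hGF
  have hpair : ∀ g : ℝ → ℂ, Continuous g → HasCompactSupport g →
      ∫ x : Fin d → ℝ, g (splitQR d x) * Φ x = ∫ ξ : ℝ, g ξ * f ξ := by
    intro g hg hgc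
    rw [← hf2 g hg hgc, ← (splitMap_mp m d hm).integral_comp (splitMap_me m d hm)]
    simp only [splitQR_splitMap, hΨe]
  refine ⟨f, hf1, fun g hg hgc _ => hpair g hg hgc, ?_, hf3, ?_⟩
  · intro f' hf' hp
    refine uniq_off (hf' 0).continuousOn (hf1 0).continuousOn fun g hg hgc hgs => ?_
    have hgc' : HasCompactSupport (fun x => (g x : ℂ)) := hgc.comp_left (g := fun x : ℝ => (x : ℂ)) (by simp)
    have hgk : Continuous (fun x => (g x : ℂ)) := Complex.continuous_ofReal.comp hg.continuous
    rw [← hp _ hgk hgc' ?_, ← hpair _ hgk hgc']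
    have hsub : tsupport (fun x => (g x : ℂ)) ⊆ tsupport g := closure_mono fun x hx => by
      simpa using hx
    exact fun h0 => hgs (hsub h0) rfl
  · refine ⟨C₀, C₁, hC0, hC1, fun ξ hξ => ?_⟩
    rw [hC ξ hξ, mul_assoc, show d / 2 - 1 = m - 1 by omega]
    congr 2
    have hab : |ξ| ≠ 0 := abs_ne_zero.2 hξ
    by_cases ho : Odd m
    · have h4 : d % 4 = 2 := by obtain ⟨r, hr⟩ := ho; omega
      have hev : Even (m - 1) := by obtain ⟨r, hr⟩ := ho; exact ⟨r, by omega⟩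
      rw [wmod, if_pos ho, if_pos h4, hev.pow_abs]
      push_cast; ring
    · have h4 : ¬ d % 4 = 2 := by
        rw [Nat.not_odd_iff_even] at ho
        obtain ⟨r, hr⟩ := ho; omega
      have hod : Odd (m - 1) := by
        rw [Nat.not_odd_iff_even] at ho
        obtain ⟨r, hr⟩ := ho
        exact ⟨r - 1, by omega⟩
      rw [wmod, if_neg ho, if_neg h4, mul_one]
      norm_cast
      rcases lt_or_gt_of_ne hξ with h | h
      · rw [abs_of_neg h, hod.neg_pow]; field_simp
      · rw [abs_of_pos h]; field_simp
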